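/- arXiv:math/0504518 — 3 statements merged into one kernel-verified Lean document; each statement's English description precedes it below -/
import Mathlib

section
/- Let H be a finite connected graph with N vertices and maximum degree δ ≥ 3, and let β_1 ≥ β_2 ≥ ⋯ ≥ β_N be the eigenvalues of its RRW transition matrix A = I − (1/δ)L. Then for every B ∈ {0, …, N−2}, β_{B+2} ≤ 1 − (4/(δN²))·((B+1)/2)^{2ν}, where ν = 1/((δ−1)·ln 16). -/
open Real

namespace RootedForest

variable {V : Type*}

/-- `w` is an ancestor of `u` (possibly `u` itself) for the parent map `p`. -/
def Anc (p : V → V) (u w : V) : Prop := ∃ i : ℕ, p^[i] u = w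

theorem Anc.refl (p : V → V) (u : V) : Anc p u u := ⟨0, rfl⟩

theorem Anc.trans {p : V → V} {u v w : V} (h₁ : Anc p u v) (h₂ : Anc p v w) : Anc p u w := by
  obtain ⟨i, rfl⟩ := h₁
  obtain ⟨j, rfl⟩ := h₂
  exact ⟨j + i, Function.iterate_add_apply p j i u⟩

theorem Anc.parent (p : V → V) (u : V) : Anc p u (p u) := ⟨1, rfl⟩

theorem Anc.eq_or_parent {p : V → V} {u w : V} (h : Anc p u w) : w = u ∨ Anc p (p u) w := by
  obtain ⟨i, rfl⟩ := h
  cases i with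
  | zero => exact Or.inl rfl
  | succ i => exact Or.inr ⟨i, rfl⟩

theorem Anc.total {p : V → V} {u v w : V} (h₁ : Anc p u v) (h₂ : Anc p u w) :
    Anc p v w ∨ Anc p w v := by
  obtain ⟨i, rfl⟩ := h₁
  obtain ⟨j, rfl⟩ := h₂
  rcases le_total i j with h | h
  · exact Or.inl ⟨j - i, by rw [← Function.iterate_add_apply, Nat.sub_add_cancel h]⟩
  · exact Or.inr ⟨i - j, by rw [← Function.iterate_add_apply, Nat.sub_add_cancel h]⟩

/-- A parent map `p` with root `r`, along which the depth `d` strictly decreases. -/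
structure IsRooted (p : V → V) (r : V) (d : V → ℕ) : Prop where
  root : p r = r
  depth_lt : ∀ v, v ≠ r → d (p v) < d v

namespace IsRooted

variable {p : V → V} {r : V} {d : V → ℕ}

theorem induction (h : IsRooted p r d) {P : V → Prop} (root : P r)
    (step : ∀ v, v ≠ r → P (p v) → P v) (v : V) : P v := by
  induction hn : d v using Nat.strong_induction_on generalizing v with
  | _ n ih =>
    by_cases hv : v = r
    · exact hv ▸ root
    · exact step v hv (ih _ (hn ▸ h.depth_lt v hv) _ rfl)

theorem anc_root (h : IsRooted p r d) (v : V) : Anc p v r :=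
  h.induction (P := fun v => Anc p v r) (Anc.refl p r) (fun v _ ih => (Anc.parent p v).trans ih) v

theorem depth_le (h : IsRooted p r d) {u w : V} (huw : Anc p u w) : d w ≤ d u := by
  induction u using h.induction with
  | root =>
    obtain ⟨i, rfl⟩ := huw
    rw [Function.iterate_fixed h.root]
  | step u hu ih =>
    rcases huw.eq_or_parent with rfl | h'
    · exact le_rfl
    · exact (ih h').trans (h.depth_lt u hu).le

theorem eq_of_anc_of_depth_le (h : IsRooted p r d) {u w : V} (huw : Anc p u w)
    (hd : d u ≤ d w) : w = u := by
  rcases huw.eq_or_parent with h' | h'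
  · exact h'
  · by_cases hu : u = r
    · subst hu
      obtain ⟨i, rfl⟩ := huw
      exact Function.iterate_fixed h.root i
    · have := h.depth_le h'
      have := h.depth_lt u hu
      omega

theorem mem_of_anc {U : Finset V} (hU : ∀ v ∈ U, p v ∈ U) {u w : V} (hu : u ∈ U)
    (huw : Anc p u w) : w ∈ U := by
  obtain ⟨i, rfl⟩ := huw
  induction i generalizing u with
  | zero => exact hu
  | succ i ih => exact ih (hU u hu)

open Classical in
theorem sub_root_eq_sum [Fintype V] (h : IsRooted p r d) (f : V → ℝ) (u : V) :
    f u - f r = ∑ w, if Anc p u w then f w - f (p w) else 0 := by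
  induction u using h.induction with
  | root =>
    rw [sub_self]
    refine (Finset.sum_eq_zero fun w _ => ?_).symm
    split_ifs with hw
    · obtain ⟨i, rfl⟩ := hw
      rw [Function.iterate_fixed h.root, h.root, sub_self]
    · rfl
  | step u hu ih =>
    have key : ∀ w, (if Anc p u w then f w - f (p w) else 0) =
        (if w = u then f u - f (p u) else 0) + if Anc p (p u) w then f w - f (p w) else 0 := by
      intro w
      by_cases hw : w = u
      · subst hw
        have hn : ¬ Anc p (p w) w := fun h' =>
          absurd (h.depth_le h') (not_le.mpr (h.depth_lt w hu))
        simp [Anc.refl, hn]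
      · have : Anc p u w ↔ Anc p (p u) w :=
          ⟨fun h' => h'.eq_or_parent.resolve_left hw, fun h' => (Anc.parent p u).trans h'⟩
        simp [hw, this]
    rw [Finset.sum_congr rfl fun w _ => key w, Finset.sum_add_distrib, ← ih]
    simp

theorem sq_sub_le [Fintype V] (h : IsRooted p r d) (f : V → ℝ) (u v : V) (W : Finset V)
    (h₁ : ∀ w, Anc p u w → ¬ Anc p v w → w ∈ W) (h₂ : ∀ w, Anc p v w → ¬ Anc p u w → w ∈ W) :
    (f u - f v) ^ 2 ≤ W.card * ∑ w ∈ W, (f w - f (p w)) ^ 2 := by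
  classical
  have e : f u - f v = ∑ w ∈ W, ((if Anc p u w then f w - f (p w) else 0) -
      if Anc p v w then f w - f (p w) else 0) := by
    rw [← sub_sub_sub_cancel_right _ _ (f r), h.sub_root_eq_sum, h.sub_root_eq_sum,
      ← Finset.sum_sub_distrib]
    refine (Finset.sum_subset (Finset.subset_univ W) fun w _ hw => ?_).symm
    by_cases hu : Anc p u w <;> by_cases hv : Anc p v w
    · simp [hu, hv]
    · exact absurd (h₁ w hu hv) hw
    · exact absurd (h₂ w hv hu) hw
    · simp [hu, hv]
  rw [e]
  refine sq_sum_le_card_mul_sum_sq.trans ?_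
  refine mul_le_mul_of_nonneg_left (Finset.sum_le_sum fun w _ => ?_) (Nat.cast_nonneg _)
  split_ifs <;> nlinarith [sq_nonneg (f w - f (p w))]

/-- A small parent-closed set that is the parent side of an edge to a zero `s` of `f`. -/
theorem sum_sq_le_of_anchor [Fintype V] [DecidableEq V] (h : IsRooted p r d) {U : Finset V}
    (hU : ∀ v ∈ U, p v ∈ U) {m : ℕ} (hm : U.card ≤ m) {s : V} (hs : s ∉ U) (hps : p s ∈ U)
    {f : V → ℝ} (hf : f s = 0) :
    ∑ u ∈ U, f u ^ 2 ≤ (m : ℝ) ^ 2 * ∑ w ∈ insert s U, (f w - f (p w)) ^ 2 := by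
  have hr : r ∈ U := mem_of_anc hU hps (h.anc_root _)
  set E := ∑ w ∈ insert s U, (f w - f (p w)) ^ 2
  have hE0 : 0 ≤ E := Finset.sum_nonneg fun _ _ => sq_nonneg _
  have hm' : (U.card : ℝ) ≤ m := by exact_mod_cast hm
  have key : ∀ u ∈ U, f u ^ 2 ≤ m * E := by
    intro u hu
    have hle := h.sq_sub_le f u s (insert s (U.erase r))
      (fun w hw hn => Finset.mem_insert_of_mem (Finset.mem_erase.mpr
        ⟨fun e => hn (e ▸ h.anc_root s), mem_of_anc hU hu hw⟩))
      (fun w hw hn => by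
        rcases hw.eq_or_parent with rfl | hw'
        · exact Finset.mem_insert_self _ _
        · exact Finset.mem_insert_of_mem (Finset.mem_erase.mpr
            ⟨fun e => hn (e ▸ h.anc_root u), mem_of_anc hU hps hw'⟩))
    have hc : (insert s (U.erase r)).card = U.card := by
      rw [Finset.card_insert_of_notMem (fun e => hs (Finset.mem_of_mem_erase e)),
        Finset.card_erase_add_one hr]
    rw [hf, sub_zero, hc] at hle
    refine hle.trans (mul_le_mul hm' ?_ (Finset.sum_nonneg fun _ _ => sq_nonneg _) (by positivity))
    exact Finset.sum_le_sum_of_subset_of_nonneg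
      (Finset.insert_subset_insert _ (Finset.erase_subset _ _)) fun _ _ _ => sq_nonneg _
  calc ∑ u ∈ U, f u ^ 2 ≤ U.card • (m * E) := Finset.sum_le_card_nsmul _ _ _ key
    _ = U.card * (m * E) := nsmul_eq_mul _ _
    _ ≤ m * (m * E) := by gcongr
    _ = m ^ 2 * E := by ring

open Classical in
/-- If the proper subtrees of `v` have at most `m` vertices and `f` vanishes at `v`, then `f`
satisfies a Poincaré inequality on the subtree of `v`. -/
theorem sum_sq_le_of_subtree [Fintype V] [DecidableEq V] (h : IsRooted p r d) {U : Finset V}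
    (hU : ∀ v ∈ U, p v ∈ U) {m : ℕ} {v : V}
    (hmax : ∀ w ∈ U, d v < d w → (U.filter fun u => Anc p u w).card ≤ m)
    {f : V → ℝ} (hf : f v = 0) :
    ∑ u ∈ U with Anc p u v, f u ^ 2 ≤
      (m : ℝ) ^ 2 * ∑ w ∈ (U.filter fun u => Anc p u v).erase v, (f w - f (p w)) ^ 2 := by
  set D := U.filter fun u => Anc p u v
  have hdep : ∀ w ∈ D.erase v, w ∈ U ∧ d v < d w := by
    intro w hw
    obtain ⟨hne, hwD⟩ := Finset.mem_erase.mp hw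
    obtain ⟨hwU, hwv⟩ := Finset.mem_filter.mp hwD
    refine ⟨hwU, lt_of_not_ge fun hle => hne (h.eq_of_anc_of_depth_le hwv hle).symm⟩
  have key : ∀ u ∈ D, f u ^ 2 ≤
      m * ∑ w ∈ D.erase v, if Anc p u w then (f w - f (p w)) ^ 2 else 0 := by
    intro u hu
    obtain ⟨huU, huv⟩ := Finset.mem_filter.mp hu
    set W := (D.erase v).filter fun w => Anc p u w with hW
    have hle := h.sq_sub_le f u v W
      (fun w hw hn => by
        have hwv : Anc p w v := (hw.total huv).resolve_right hn
        refine Finset.mem_filter.mpr ⟨Finset.mem_erase.mpr ⟨?_, ?_⟩, hw⟩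
        · rintro rfl
          exact hn (Anc.refl p _)
        · exact Finset.mem_filter.mpr ⟨mem_of_anc hU huU hw, hwv⟩)
      (fun w hw hn => absurd (huv.trans hw) hn)
    have hc : W.card ≤ m := by
      rcases W.eq_empty_or_nonempty with h0 | h0
      · simp [h0]
      · obtain ⟨t, ht, hmin⟩ := W.exists_min_image d h0
        obtain ⟨ht₁, ht₂⟩ := Finset.mem_filter.mp ht
        refine (Finset.card_le_card fun w hw => ?_).trans
          (hmax t (hdep t ht₁).1 (hdep t ht₁).2)
        obtain ⟨hw₁, hw₂⟩ := Finset.mem_filter.mp hw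
        refine Finset.mem_filter.mpr ⟨(hdep w hw₁).1, ?_⟩
        rcases hw₂.total ht₂ with h' | h'
        · exact h'
        · rw [h.eq_of_anc_of_depth_le h' (hmin w hw)]
          exact Anc.refl p t
    rw [hf, sub_zero, hW, Finset.sum_filter] at hle
    refine hle.trans (mul_le_mul_of_nonneg_right (by exact_mod_cast hc) ?_)
    exact Finset.sum_nonneg fun w _ => by positivity
  calc ∑ u ∈ D, f u ^ 2
      ≤ ∑ u ∈ D, m * ∑ w ∈ D.erase v, (if Anc p u w then (f w - f (p w)) ^ 2 else 0) :=
        Finset.sum_le_sum key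
    _ = m * ∑ w ∈ D.erase v, ∑ u ∈ D, (if Anc p u w then (f w - f (p w)) ^ 2 else 0) := by
        rw [← Finset.mul_sum, Finset.sum_comm]
    _ ≤ m * ∑ w ∈ D.erase v, m * (f w - f (p w)) ^ 2 := by
        gcongr with w hw
        rw [← Finset.sum_filter, Finset.sum_const, nsmul_eq_mul]
        gcongr
        refine (Finset.card_le_card fun u hu => ?_).trans (hmax w (hdep w hw).1 (hdep w hw).2)
        obtain ⟨h₁, h₂⟩ := Finset.mem_filter.mp hu
        exact Finset.mem_filter.mpr ⟨(Finset.mem_filter.mp h₁).1, h₂⟩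
    _ = m ^ 2 * ∑ w ∈ D.erase v, (f w - f (p w)) ^ 2 := by rw [← Finset.mul_sum]; ring

theorem exists_vanishing_set_aux [Fintype V] [DecidableEq V] (h : IsRooted p r d) (m k : ℕ)
    (U : Finset V) (hU : ∀ v ∈ U, p v ∈ U) (hk : U.card ≤ k * (m + 1) + m) (s : V)
    (hs : m < U.card ∨ s ∉ U ∧ p s ∈ U) :
    ∃ S : Finset V, S.card ≤ k ∧ ∀ f : V → ℝ, (∀ v ∈ S, f v = 0) → (s ∉ U → f s = 0) →
      ∑ u ∈ U, f u ^ 2 ≤ (m : ℝ) ^ 2 * ∑ w ∈ insert s U, (f w - f (p w)) ^ 2 := by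
  classical
  induction k generalizing U s with
  | zero =>
    obtain ⟨hs, hps⟩ := hs.resolve_left (by omega)
    exact ⟨∅, by simp, fun f _ hf => h.sum_sq_le_of_anchor hU (by omega) hs hps (hf hs)⟩
  | succ k ih =>
    by_cases hm : U.card ≤ m
    · obtain ⟨hs, hps⟩ := hs.resolve_left (by omega)
      exact ⟨∅, by simp, fun f _ hf => h.sum_sq_le_of_anchor hU hm hs hps (hf hs)⟩
    push Not at hm
    obtain ⟨x, hx⟩ : U.Nonempty := Finset.card_pos.mp (by omega)
    have hr : r ∈ U := mem_of_anc hU hx (h.anc_root x)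
    obtain ⟨v, hv, hvmax⟩ :=
      (U.filter fun w => m < (U.filter fun u => Anc p u w).card).exists_max_image d
        ⟨r, Finset.mem_filter.mpr ⟨hr, by
          rwa [Finset.filter_true_of_mem fun u _ => h.anc_root u]⟩⟩
    obtain ⟨hvU, hvm⟩ := Finset.mem_filter.mp hv
    have hmax : ∀ w ∈ U, d v < d w → (U.filter fun u => Anc p u w).card ≤ m := by
      intro w hw hlt
      by_contra! hc
      exact absurd (hvmax w (Finset.mem_filter.mpr ⟨hw, hc⟩)) (not_le.mpr hlt)
    set D := U.filter fun u => Anc p u v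
    set U' := U.filter fun u => ¬ Anc p u v
    have hvD : v ∈ D := Finset.mem_filter.mpr ⟨hvU, Anc.refl p v⟩
    have hvU' : v ∉ U' := fun e => (Finset.mem_filter.mp e).2 (Anc.refl p v)
    have hcl : ∀ u ∈ U', p u ∈ U' := fun u hu => by
      obtain ⟨h₁, h₂⟩ := Finset.mem_filter.mp hu
      exact Finset.mem_filter.mpr ⟨hU u h₁, fun e => h₂ ((Anc.parent p u).trans e)⟩
    have hcard : D.card + U'.card = U.card := Finset.card_filter_add_card_filter_not _
    have hsplit : ∀ g : V → ℝ, ∑ u ∈ U, g u = ∑ u ∈ D, g u + ∑ u ∈ U', g u :=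
      fun g => (Finset.sum_filter_add_sum_filter_not U _ g).symm
    obtain ⟨S, hS, hSf⟩ : ∃ S : Finset V, S.card ≤ k ∧ ∀ f : V → ℝ, (∀ v ∈ S, f v = 0) →
        f v = 0 → ∑ u ∈ U', f u ^ 2 ≤
          (m : ℝ) ^ 2 * ∑ w ∈ insert v U', (f w - f (p w)) ^ 2 := by
      rcases U'.eq_empty_or_nonempty with h0 | ⟨y, hy⟩
      · refine ⟨∅, by simp, fun f _ _ => ?_⟩
        rw [h0, Finset.sum_empty]
        positivity
      · have hrv : v ≠ r := fun e => (Finset.mem_filter.mp hy).2 (e ▸ h.anc_root y)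
        have hpv : p v ∈ U' := Finset.mem_filter.mpr ⟨hU v hvU, fun e =>
          absurd (h.depth_le e) (not_le.mpr (h.depth_lt v hrv))⟩
        have : (k + 1) * (m + 1) = k * (m + 1) + (m + 1) := by ring
        obtain ⟨S, hS, hSf⟩ := ih U' hcl (by omega) v (Or.inr ⟨hvU', hpv⟩)
        exact ⟨S, hS, fun f h₁ h₂ => hSf f h₁ fun _ => h₂⟩
    refine ⟨insert v S, (Finset.card_insert_le _ _).trans (by omega), fun f hf _ => ?_⟩
    have hfv : f v = 0 := hf v (Finset.mem_insert_self _ _)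
    have h₁ := h.sum_sq_le_of_subtree hU hmax hfv
    have h₂ := hSf f (fun w hw => hf w (Finset.mem_insert_of_mem hw)) hfv
    rw [Finset.sum_insert hvU'] at h₂
    have h₃ : ∑ w ∈ U, (f w - f (p w)) ^ 2 ≤ ∑ w ∈ insert s U, (f w - f (p w)) ^ 2 :=
      Finset.sum_le_sum_of_subset_of_nonneg (Finset.subset_insert _ _) fun _ _ _ => sq_nonneg _
    refine le_trans ?_ (mul_le_mul_of_nonneg_left h₃ (sq_nonneg (m : ℝ)))
    have h₄ := Finset.add_sum_erase D (fun w => (f w - f (p w)) ^ 2) hvD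
    rw [hsplit, hsplit, ← h₄]
    linarith

/-- In a rooted tree with at most `k * (m + 1) + m` but more than `m` vertices, there are `k`
vertices such that functions vanishing there satisfy a Poincaré inequality with constant `m ^ 2`. -/
theorem exists_vanishing_set [Fintype V] (h : IsRooted p r d) (m k : ℕ)
    (hk : Fintype.card V ≤ k * (m + 1) + m) (hm : m < Fintype.card V) :
    ∃ S : Finset V, S.card ≤ k ∧ ∀ f : V → ℝ, (∀ v ∈ S, f v = 0) →
      ∑ u, f u ^ 2 ≤ (m : ℝ) ^ 2 * ∑ w, (f w - f (p w)) ^ 2 := by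
  classical
  obtain ⟨S, hS, hf⟩ := h.exists_vanishing_set_aux m k Finset.univ (by simp) (by simpa using hk)
    r (Or.inl (by simpa using hm))
  exact ⟨S, hS, fun f h0 => by simpa using hf f h0 (by simp)⟩

end IsRooted

end RootedForest

open RootedForest

theorem SimpleGraph.Connected.exists_isRooted {V : Type*} {G : SimpleGraph V}
    (hG : G.Connected) :
    ∃ (p : V → V) (r : V) (d : V → ℕ), IsRooted p r d ∧ ∀ v, v ≠ r → G.Adj v (p v) := by
  classical
  obtain ⟨r⟩ := hG.nonempty
  have key : ∀ v, v ≠ r → ∃ w, G.Adj v w ∧ G.dist w r < G.dist v r := by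
    intro v hv
    obtain ⟨q, hq⟩ := hG.exists_walk_length_eq_dist v r
    cases q with
    | nil => exact absurd rfl hv
    | cons hadj q =>
      refine ⟨_, hadj, ?_⟩
      have := SimpleGraph.dist_le q
      rw [SimpleGraph.Walk.length_cons] at hq
      omega
  choose! q hq using key
  refine ⟨fun v => if v = r then r else q v, r, fun v => G.dist v r, ⟨by simp, ?_⟩, ?_⟩
  · intro v hv
    simpa [hv] using (hq v hv).2
  · intro v hv
    simpa [hv] using (hq v hv).1

theorem sum_sq_sub_parent_le {V : Type*} [Fintype V] [DecidableEq V] {G : SimpleGraph V}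
    [DecidableRel G.Adj] {p : V → V} {r : V} {d : V → ℕ} (h : IsRooted p r d)
    (hadj : ∀ v, v ≠ r → G.Adj v (p v)) (f : V → ℝ) :
    ∑ v, (f v - f (p v)) ^ 2 ≤ (∑ i, ∑ j, if G.Adj i j then (f i - f j) ^ 2 else 0) / 2 := by
  have h₁ : ∑ v, (f v - f (p v)) ^ 2 =
      ∑ v, ∑ w, if v ≠ r ∧ w = p v then (f v - f w) ^ 2 else 0 := by
    refine Finset.sum_congr rfl fun v _ => ?_
    by_cases hv : v = r
    · simp [hv, h.root]
    · simp [hv]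
  have h₂ : ∑ v, (f v - f (p v)) ^ 2 =
      ∑ v, ∑ w, if w ≠ r ∧ v = p w then (f v - f w) ^ 2 else 0 := by
    rw [h₁, Finset.sum_comm]
    refine Finset.sum_congr rfl fun v _ => Finset.sum_congr rfl fun w _ => ?_
    rw [← neg_sub, neg_sq]
  rw [le_div_iff₀ two_pos, mul_two]
  nth_rewrite 1 [h₁]
  rw [h₂]
  simp only [← Finset.sum_add_distrib]
  refine Finset.sum_le_sum fun v _ => Finset.sum_le_sum fun w _ => ?_
  by_cases hvw : v ≠ r ∧ w = p v
  · have hn : ¬ (w ≠ r ∧ v = p w) := by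
      rintro ⟨hw, e⟩
      have a := h.depth_lt v hvw.1
      have b := h.depth_lt w hw
      rw [← hvw.2] at a
      rw [← e] at b
      omega
    rw [if_pos hvw, if_neg hn, if_pos (hvw.2 ▸ hadj v hvw.1), add_zero]
  · rw [if_neg hvw, zero_add]
    split_ifs with h₃ h₄ h₄
    · exact le_rfl
    · exact absurd (h₃.2 ▸ (hadj w h₃.1).symm) h₄
    · exact sq_nonneg _
    · exact le_rfl

/-- A connected graph on more than `m` and at most `k * (m + 1) + m` vertices has `k` vertices
such that functions vanishing there have Laplacian energy at least `‖f‖² / m²`. -/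
theorem SimpleGraph.Connected.exists_vanishing_set {V : Type*} [Fintype V] [DecidableEq V]
    {G : SimpleGraph V} [DecidableRel G.Adj] (hG : G.Connected) (m k : ℕ)
    (hk : Fintype.card V ≤ k * (m + 1) + m) (hm : m < Fintype.card V) :
    ∃ S : Finset V, S.card ≤ k ∧ ∀ f : V → ℝ, (∀ v ∈ S, f v = 0) →
      f ⬝ᵥ f ≤ (m : ℝ) ^ 2 * (f ⬝ᵥ (G.lapMatrix ℝ).mulVec f) := by
  obtain ⟨p, r, d, h, hadj⟩ := hG.exists_isRooted
  obtain ⟨S, hS, hf⟩ := h.exists_vanishing_set m k hk hm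
  refine ⟨S, hS, fun f h0 => ?_⟩
  rw [← Matrix.toLinearMap₂'_apply', SimpleGraph.lapMatrix_toLinearMap₂']
  have : f ⬝ᵥ f = ∑ u, f u ^ 2 := by simp [dotProduct, sq]
  rw [this]
  exact (hf f h0).trans
    (mul_le_mul_of_nonneg_left (sum_sq_sub_parent_le h hadj f) (sq_nonneg _))

/-- The half of the min-max principle bounding an eigenvalue by a quadratic form on the functions
vanishing on a small set. -/
theorem Matrix.IsHermitian.eigenvalue_le_of_vanishing {V : Type*} [Fintype V] [DecidableEq V]
    {A : Matrix V V ℝ} (hA : A.IsHermitian) {n : ℕ} (τ : Fin n → V)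
    (hτ : Function.Injective τ) {b c : ℝ} (hb : ∀ i, b ≤ hA.eigenvalues (τ i))
    {S : Finset V} (hS : S.card < n)
    (hc : ∀ f : V → ℝ, (∀ v ∈ S, f v = 0) → f ⬝ᵥ A.mulVec f ≤ c * (f ⬝ᵥ f)) : b ≤ c := by
  let e : Fin n → V → ℝ := fun i => ⇑(hA.eigenvectorBasis (τ i))
  have he : ∀ i j, e i ⬝ᵥ e j = if i = j then 1 else 0 := by
    intro i j
    have := orthonormal_iff_ite.mp hA.eigenvectorBasis.orthonormal (τ i) (τ j)
    rw [EuclideanSpace.inner_eq_star_dotProduct] at this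
    simpa [e, dotProduct_comm, hτ.eq_iff] using this
  have hAe : ∀ i, A.mulVec (e i) = hA.eigenvalues (τ i) • e i :=
    fun i => hA.mulVec_eigenvectorBasis (τ i)
  let T : (Fin n → ℝ) →ₗ[ℝ] (S → ℝ) :=
    { toFun := fun x v => ∑ i, x i * e i v
      map_add' := fun x y => by
        ext v; simp [add_mul, Finset.sum_add_distrib]
      map_smul' := fun a x => by
        ext v; simp [Finset.mul_sum, mul_assoc] }
  have hker : T.ker ≠ ⊥ := LinearMap.ker_ne_bot_of_finrank_lt (by simpa using hS)
  obtain ⟨x, hx, hx0⟩ := Submodule.exists_mem_ne_zero_of_ne_bot hker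
  let f : V → ℝ := ∑ i, x i • e i
  have hfS : ∀ v ∈ S, f v = 0 := fun v hv => by
    have := congrFun (LinearMap.mem_ker.mp hx) ⟨v, hv⟩
    simpa [f, T] using this
  have hff : f ⬝ᵥ f = ∑ i, x i ^ 2 := by
    simp [f, sum_dotProduct, dotProduct_sum, he, sq]
  have hfA : f ⬝ᵥ A.mulVec f = ∑ i, hA.eigenvalues (τ i) * x i ^ 2 := by
    simp only [f, Matrix.mulVec_sum, Matrix.mulVec_smul, hAe, sum_dotProduct, dotProduct_sum,
      smul_dotProduct, dotProduct_smul, he, smul_eq_mul]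
    simp [sq, mul_left_comm]
  have hpos : 0 < ∑ i, x i ^ 2 := by
    obtain ⟨i, hi⟩ := Function.ne_iff.mp hx0
    exact Finset.sum_pos' (fun _ _ => sq_nonneg _) ⟨i, Finset.mem_univ _, by
      have : x i ≠ 0 := hi
      positivity⟩
  have hle := hc f hfS
  rw [hff, hfA] at hle
  refine le_of_mul_le_mul_right (le_trans ?_ hle) hpos
  rw [Finset.mul_sum]
  exact Finset.sum_le_sum fun i _ => mul_le_mul_of_nonneg_right (hb i) (sq_nonneg _)

/-- **Higher eigenvalue bound for the RRW on a finite connected graph.**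
For a finite connected graph on `N` vertices with maximum degree `δ ≥ 3` and
`ν = 1/((δ-1)·ln 16)`, the non-increasingly enumerated RRW eigenvalues satisfy
`β_{B+2} ≤ 1 - (4/(δN²))·((B+1)/2)^{2ν}` for every `B ∈ {0,…,N-2}`. -/
theorem rrw_higher_eigenvalue_bound {V : Type} [Fintype V] [DecidableEq V]
    (G : SimpleGraph V) [DecidableRel G.Adj] (hG : G.Connected)
    (δ : ℕ) (hδeq : δ = G.maxDegree) (hδ : 3 ≤ δ)
    (ν : ℝ) (hν : ν = 1 / (((δ : ℝ) - 1) * Real.log 16))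
    (hA : ((1 : Matrix V V ℝ) - ((δ : ℝ))⁻¹ • G.lapMatrix ℝ).IsHermitian)
    (β : Fin (Fintype.card V) → ℝ) (hβ : Antitone β)
    (hβe : ∃ σ : Fin (Fintype.card V) ≃ V, β = hA.eigenvalues ∘ σ)
    (B : ℕ) (hB : B + 2 ≤ Fintype.card V) :
    β ⟨B + 1, by omega⟩ ≤
      1 - 4 / ((δ : ℝ) * (Fintype.card V : ℝ) ^ 2) *
        (((B : ℝ) + 1) / 2) ^ (2 * ν) := by
  have hδ' : (3 : ℝ) ≤ δ := by exact_mod_cast hδ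
  obtain ⟨σ, rfl⟩ := hβe
  set m := Fintype.card V / (B + 2)
  have hm1 : 1 ≤ m := (Nat.one_le_div_iff (by omega)).mpr hB
  have hmN : m * (B + 2) ≤ Fintype.card V := Nat.div_mul_le_self _ _
  have hlt : Fintype.card V < (B + 2) * (m + 1) := by
    have := Nat.lt_mul_div_succ (Fintype.card V) (show 0 < B + 2 by omega)
    simpa using this
  obtain ⟨S, hS, hf⟩ := hG.exists_vanishing_set m (B + 1) (by
    have : (B + 2) * (m + 1) = (B + 1) * (m + 1) + m + 1 := by ring
    omega) (by nlinarith)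
  have hm0 : (0 : ℝ) < m := by exact_mod_cast hm1
  have hev : (hA.eigenvalues ∘ σ) ⟨B + 1, by omega⟩ ≤ 1 - (δ : ℝ)⁻¹ * ((m : ℝ) ^ 2)⁻¹ := by
    refine hA.eigenvalue_le_of_vanishing (n := B + 2)
      (fun i => σ (Fin.castLE hB i)) (fun i j hij => Fin.castLE_injective hB (σ.injective hij))
      (fun i => hβ (Fin.le_def.mpr (by simpa using Nat.lt_succ_iff.mp i.isLt)))
      (S := S) (by omega) fun f h0 => ?_
    rw [Matrix.sub_mulVec, Matrix.one_mulVec, Matrix.smul_mulVec, dotProduct_sub,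
      dotProduct_smul, smul_eq_mul, sub_mul, one_mul, mul_assoc]
    gcongr
    rw [inv_mul_le_iff₀ (by positivity)]
    exact hf f h0
  refine hev.trans ?_
  have hlog : 2 < Real.log 16 := by
    have : Real.log 16 = 4 * Real.log 2 := by
      rw [show (16 : ℝ) = 2 ^ 4 by norm_num, Real.log_pow]
      norm_num
    have := Real.log_two_gt_d9
    linarith
  have hν2 : 2 * ν ≤ (2 : ℕ) := by
    have : ν ≤ 1 := by
      rw [hν, div_le_one (by nlinarith)]
      nlinarith
    push_cast
    linarith
  have hν0 : 0 ≤ 2 * ν := by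
    rw [hν]
    have : 0 < ((δ : ℝ) - 1) * Real.log 16 := by nlinarith
    positivity
  have hpow : (((B : ℝ) + 1) / 2) ^ (2 * ν) ≤ (((B : ℝ) + 2) / 2) ^ 2 := by
    have hB0 : (0 : ℝ) ≤ B := Nat.cast_nonneg B
    calc (((B : ℝ) + 1) / 2) ^ (2 * ν) ≤ (((B : ℝ) + 2) / 2) ^ (2 * ν) := by
          gcongr
          norm_num
      _ ≤ (((B : ℝ) + 2) / 2) ^ ((2 : ℕ) : ℝ) :=
          Real.rpow_le_rpow_of_exponent_le (by linarith) hν2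
      _ = _ := Real.rpow_natCast _ _
  have hN0 : (0 : ℝ) < Fintype.card V := by
    have : 0 < Fintype.card V := by omega
    exact_mod_cast this
  have hmN' : (m : ℝ) * (B + 2) ≤ Fintype.card V := by exact_mod_cast hmN
  gcongr 1 - ?_
  calc 4 / ((δ : ℝ) * (Fintype.card V : ℝ) ^ 2) * (((B : ℝ) + 1) / 2) ^ (2 * ν)
      ≤ 4 / ((δ : ℝ) * (Fintype.card V : ℝ) ^ 2) * (((B : ℝ) + 2) / 2) ^ 2 := by gcongr
    _ = (δ : ℝ)⁻¹ * (((B : ℝ) + 2) ^ 2 / (Fintype.card V : ℝ) ^ 2) := by field_simp; ring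
    _ ≤ (δ : ℝ)⁻¹ * ((m : ℝ) ^ 2)⁻¹ := by
        gcongr
        rw [div_le_iff₀ (by positivity), ← div_eq_inv_mul, le_div_iff₀ (by positivity),
          ← mul_pow, mul_comm]
        gcongr
end

section
/- Let H be a finite connected graph on N vertices with maximum degree δ ≥ 3 and RRW eigenvalues β_1 ≥ ⋯ ≥ β_N; let β^o_j = 1 − (2/δ)(1 − cos((j−1)π/N)) be the RRW eigenvalues of the path P_N. Then for every B ∈ {0,…,N−2}: β_{B+1} ≤ β^o_{⌊(B/2)^ν⌋ + 1}, where ν = 1/((δ−1) ln 16) and ⌊·⌋ is the floor. -/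
open Real

/-- Discrete Dirichlet inequality on `{0, …, n}`. -/
theorem discrete_dirichlet_inequality {n : ℕ} (hn : 2 ≤ n) (a : ℕ → ℝ) (h0 : a 0 = 0)
    (han : a n = 0) :
    2 * (1 - cos (π / n)) * ∑ i ∈ Finset.range n, a i ^ 2 ≤
      ∑ i ∈ Finset.range n, (a (i + 1) - a i) ^ 2 := by
  set θ : ℝ := π / n with hθ
  have hn0 : (0 : ℝ) < n := by positivity
  have hnθ : (n : ℝ) * θ = π := by rw [hθ]; field_simp
  have hθ0 : 0 < θ := by positivity
  have hs : ∀ k : ℕ, 1 ≤ k → k < n → 0 < sin (k * θ) := by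
    intro k hk hkn
    have hk' : (0 : ℝ) < k := by exact_mod_cast hk
    apply sin_pos_of_pos_of_lt_pi (by positivity)
    rw [← hnθ]
    have : (k : ℝ) < n := by exact_mod_cast hkn
    gcongr
  have hrec : ∀ k : ℕ, sin (((k + 2 : ℕ) : ℝ) * θ) =
      2 * cos θ * sin (((k + 1 : ℕ) : ℝ) * θ) - sin (k * θ) := by
    intro k
    have h1 : ((k + 2 : ℕ) : ℝ) * θ = ((k + 1 : ℕ) : ℝ) * θ + θ := by push_cast; ring
    have h2 : (k : ℝ) * θ = ((k + 1 : ℕ) : ℝ) * θ - θ := by push_cast; ring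
    rw [h1, h2, sin_add, sin_sub]; ring
  have key : ∀ k : ℕ, k < n →
      2 * (1 - cos θ) * ∑ i ∈ Finset.range (k + 1), a i ^ 2 +
        a k ^ 2 * (sin (((k + 1 : ℕ) : ℝ) * θ) / sin (k * θ) - 1) ≤
      ∑ i ∈ Finset.range k, (a (i + 1) - a i) ^ 2 := by
    intro k
    induction k with
    | zero => intro _; simp [h0]
    | succ k ih =>
      intro hk
      have ih := ih (by omega)
      rw [Finset.sum_range_succ, Finset.sum_range_succ (fun i => (a (i + 1) - a i) ^ 2)]
      have hp := hs (k + 1) (by omega) hk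
      rw [hrec k]
      set S := sin (((k + 1 : ℕ) : ℝ) * θ)
      have hdiv : (2 * cos θ * S - sin (k * θ)) / S = 2 * cos θ - sin (k * θ) / S := by
        field_simp
      rw [hdiv]
      rcases Nat.eq_zero_or_pos k with rfl | hk0
      · simp [h0] at ih ⊢
        linarith
      · have hq := hs k hk0 (by omega)
        set T := sin ((k : ℝ) * θ)
        have hsq : 2 * a k * a (k + 1) ≤ a k ^ 2 * (S / T) + a (k + 1) ^ 2 * (T / S) := by
          have : a k ^ 2 * (S / T) + a (k + 1) ^ 2 * (T / S) - 2 * a k * a (k + 1) =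
              (a k * S - a (k + 1) * T) ^ 2 / (S * T) := by
            field_simp; ring
          have h3 : 0 ≤ (a k * S - a (k + 1) * T) ^ 2 / (S * T) := by positivity
          linarith
        linarith
  obtain ⟨k, rfl⟩ : ∃ k, n = k + 1 := ⟨n - 1, by omega⟩
  have h := key k (by omega)
  rw [hnθ, sin_pi, zero_div] at h
  rw [Finset.sum_range_succ (fun i => (a (i + 1) - a i) ^ 2), han]
  linarith

/-- The spectral gap of the path with `n + 1` vertices, as a Poincaré inequality. -/
theorem path_poincare_inequality {n : ℕ} (hn : 1 ≤ n) (x : ℕ → ℝ)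
    (hx : ∑ i ∈ Finset.range (n + 1), x i = 0) :
    2 * (1 - cos (π / (n + 1 : ℕ))) * ∑ i ∈ Finset.range (n + 1), x i ^ 2 ≤
      ∑ i ∈ Finset.range n, (x (i + 1) - x i) ^ 2 := by
  set S : ℕ → ℝ := fun k => ∑ i ∈ Finset.range k, x i with hS
  have hSsucc : ∀ k, S (k + 1) = S k + x k := fun k => Finset.sum_range_succ _ _
  have hD := discrete_dirichlet_inequality (n := n + 1) (by omega) S (by simp [hS]) hx
  have hparts : ∀ k, ∑ i ∈ Finset.range (k + 1), x i ^ 2 =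
      S (k + 1) * x k - ∑ i ∈ Finset.range k, S (i + 1) * (x (i + 1) - x i) := by
    intro k
    induction k with
    | zero => simp [hS]; ring
    | succ k ih =>
      rw [Finset.sum_range_succ, ih, Finset.sum_range_succ _ k, hSsucc (k + 1)]; ring
  have hX := hparts n
  rw [show S (n + 1) = 0 from hx] at hX
  have hCS := Finset.sum_mul_sq_le_sq_mul_sq (Finset.range n) (fun i => S (i + 1))
    (fun i => x (i + 1) - x i)
  have hshift : ∑ i ∈ Finset.range (n + 1), S i ^ 2 = ∑ i ∈ Finset.range n, S (i + 1) ^ 2 := by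
    rw [Finset.sum_range_succ']; simp [hS]
  rw [hshift] at hD
  simp only [hSsucc, add_sub_cancel_left] at hD
  simp only [hSsucc] at hX hCS hD
  set X := ∑ i ∈ Finset.range (n + 1), x i ^ 2
  set Q := ∑ i ∈ Finset.range n, (S i + x i) ^ 2
  set E := ∑ i ∈ Finset.range n, (x (i + 1) - x i) ^ 2
  have hX0 : 0 ≤ X := Finset.sum_nonneg fun _ _ => sq_nonneg _
  have hE0 : 0 ≤ E := Finset.sum_nonneg fun _ _ => sq_nonneg _
  have hc0 : 0 ≤ 2 * (1 - cos (π / (n + 1 : ℕ))) := by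
    linarith [cos_le_one (π / (n + 1 : ℕ))]
  set c := 2 * (1 - cos (π / (n + 1 : ℕ)))
  have h1 : X ^ 2 ≤ Q * E := by
    rw [hX]; linarith
  rcases hX0.eq_or_lt with h | h
  · rw [← h]; simpa using hE0
  · have : c * X * X ≤ E * X := by
      calc c * X * X = c * X ^ 2 := by ring
        _ ≤ c * (Q * E) := by gcongr
        _ = (c * Q) * E := by ring
        _ ≤ X * E := by gcongr
        _ = E * X := by ring
    exact le_of_mul_le_mul_right this h

/-- Energy of a real function along a list of points. -/
def listEnergy {V : Type*} (f : V → ℝ) : List V → ℝ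
  | [] => 0
  | [_] => 0
  | a :: b :: t => (f a - f b) ^ 2 + listEnergy f (b :: t)

theorem listEnergy_nonneg {V : Type*} (f : V → ℝ) (l : List V) : 0 ≤ listEnergy f l := by
  fun_induction listEnergy f l with
  | case1 => rfl
  | case2 => rfl
  | case3 a b t ih => positivity

theorem listEnergy_append_cons {V : Type*} (f : V → ℝ) (p q : List V) (u : V) :
    listEnergy f (p ++ u :: q) = listEnergy f (p ++ [u]) + listEnergy f (u :: q) := by
  induction p with
  | nil => simp [listEnergy]
  | cons a p ih =>
    cases p with
    | nil => simp [listEnergy]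
    | cons b p => simp only [List.cons_append, listEnergy] at ih ⊢; linarith

theorem listEnergy_add_le_append {V : Type*} (f : V → ℝ) (p q : List V) :
    listEnergy f p + listEnergy f q ≤ listEnergy f (p ++ q) := by
  fun_induction listEnergy f p with
  | case1 => simp
  | case2 a =>
    cases q with
    | nil => simp [listEnergy]
    | cons b q => simp only [List.cons_append, List.nil_append, listEnergy]; nlinarith
  | case3 a b t ih =>
    simp only [List.cons_append, listEnergy] at ih ⊢
    linarith

theorem sq_sub_head_le_listEnergy {V : Type*} (f : V → ℝ) (t : List V) :
    ∀ a : V, ∀ y ∈ a :: t, (f y - f a) ^ 2 ≤ t.length * listEnergy f (a :: t) := by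
  induction t with
  | nil => intro a y hy; simp_all [listEnergy]
  | cons b t ih =>
    intro a y hy
    rcases List.mem_cons.1 hy with rfl | hy
    · rw [sub_self, zero_pow two_ne_zero]
      have := listEnergy_nonneg f (y :: b :: t)
      positivity
    · have h := ih b y hy
      have hE := listEnergy_nonneg f (b :: t)
      simp only [listEnergy, List.length_cons]
      set E := listEnergy f (b :: t)
      push_cast
      rcases Nat.eq_zero_or_pos t.length with h0 | h0
      · rw [h0] at h ⊢
        have : f y - f b = 0 := by
          have : (f y - f b) ^ 2 ≤ 0 := by simpa using h
          nlinarith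
        have : f y = f b := by linarith
        rw [this]; push_cast; nlinarith
      · have hn : (0 : ℝ) < t.length := by exact_mod_cast h0
        set n : ℝ := (t.length : ℝ)
        have h2 : (f y - f b) ^ 2 / n ≤ E := by rw [div_le_iff₀ hn]; linarith
        have h3 : 2 * (f b - f a) * (f y - f b) ≤ n * (f b - f a) ^ 2 + (f y - f b) ^ 2 / n := by
          have : n * (f b - f a) ^ 2 + (f y - f b) ^ 2 / n - 2 * (f b - f a) * (f y - f b)
              = (n * (f b - f a) - (f y - f b)) ^ 2 / n := by field_simp; ring
          have : 0 ≤ (n * (f b - f a) - (f y - f b)) ^ 2 / n := by positivity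
          linarith
        nlinarith

/-- A list of length at most `K * ℓ` admits `K` points such that every function vanishing there
satisfies a Poincaré inequality with constant `ℓ ^ 2`. -/
theorem exists_card_le_sum_sq_le_listEnergy {V : Type*} [DecidableEq V] (ℓ : ℕ) (K : ℕ) :
    ∀ l : List V, l.length ≤ K * ℓ → ∃ Z : Finset V, Z.card ≤ K ∧
      ∀ f : V → ℝ, (∀ z ∈ Z, f z = 0) →
        (l.map fun v => f v ^ 2).sum ≤ (ℓ : ℝ) ^ 2 * listEnergy f l := by
  induction K with
  | zero =>
    intro l hl
    have : l = [] := by simpa using hl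
    subst this
    exact ⟨∅, by simp, fun f _ => by simp [listEnergy]⟩
  | succ K ih =>
    intro l hl
    obtain ⟨Z, hZ, hf⟩ := ih (l.drop ℓ) (by rw [List.length_drop]; rw [add_mul] at hl; omega)
    have hlen : (l.take ℓ).length ≤ ℓ := List.length_take_le _ _
    have hsplit := List.take_append_drop ℓ l
    generalize l.take ℓ = p at hlen hsplit
    generalize l.drop ℓ = q at hf hsplit
    subst hsplit
    cases p with
    | nil => exact ⟨Z, by omega, hf⟩
    | cons a t =>
      refine ⟨insert a Z, (Finset.card_insert_le _ _).trans (by omega), fun f hfz => ?_⟩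
      have hq := hf f fun z hz => hfz z (Finset.mem_insert_of_mem hz)
      have ha : f a = 0 := hfz a (Finset.mem_insert_self _ _)
      have hE := listEnergy_nonneg f (a :: t)
      have htl : (t.length : ℝ) + 1 ≤ ℓ := by exact_mod_cast hlen
      have hp : ((a :: t).map fun v => f v ^ 2).sum ≤ (ℓ : ℝ) ^ 2 * listEnergy f (a :: t) := by
        calc ((a :: t).map fun v => f v ^ 2).sum
            ≤ ((a :: t).map fun v => f v ^ 2).length • (ℓ * listEnergy f (a :: t)) := by
              refine List.sum_le_card_nsmul _ _ fun r hr => ?_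
              obtain ⟨y, hy, rfl⟩ := List.mem_map.1 hr
              have h1 := sq_sub_head_le_listEnergy f t a y hy
              rw [ha, sub_zero] at h1
              refine h1.trans ?_
              gcongr
              exact (Nat.le_succ _).trans hlen
          _ ≤ ℓ * (ℓ * listEnergy f (a :: t)) := by
              rw [nsmul_eq_mul, List.length_map, List.length_cons]
              push_cast
              gcongr
          _ = _ := by ring
      rw [List.map_append, List.sum_append]
      have happ := listEnergy_add_le_append f (a :: t) q
      calc _ ≤ (ℓ : ℝ) ^ 2 * listEnergy f (a :: t) + (ℓ : ℝ) ^ 2 * listEnergy f q :=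
            add_le_add hp hq
        _ = (ℓ : ℝ) ^ 2 * (listEnergy f (a :: t) + listEnergy f q) := by ring
        _ ≤ _ := by gcongr

theorem SimpleGraph.Connected.exists_adj_mem_notMem {V : Type*} {G : SimpleGraph V}
    (hG : G.Connected) {S : Set V} {a b : V} (ha : a ∈ S) (hb : b ∉ S) :
    ∃ u v, G.Adj u v ∧ u ∈ S ∧ v ∉ S := by
  obtain ⟨p⟩ := hG.preconnected a b
  obtain ⟨d, -, h1, h2⟩ := p.exists_boundary_dart S ha hb
  exact ⟨_, _, d.adj, h1, h2⟩

section Energy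

variable {V : Type*} [Fintype V] (G : SimpleGraph V) [DecidableRel G.Adj]

/-- The Dirichlet form of `G`, where every edge is counted in both directions. -/
def adjEnergy (f : V → ℝ) : ℝ := ∑ u, ∑ v, if G.Adj u v then (f u - f v) ^ 2 else 0

theorem adjEnergy_nonneg (f : V → ℝ) : 0 ≤ adjEnergy G f := by
  unfold adjEnergy; positivity

variable {G}

/-- A depth-first tour: a walk through all vertices that uses each edge at most twice. -/
theorem exists_tour (hG : G.Connected) :
    ∃ l : List V, l.length + 1 = 2 * Fintype.card V ∧ (∀ v, v ∈ l) ∧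
      ∀ f : V → ℝ, listEnergy f l ≤ adjEnergy G f := by
  classical
  have key : ∀ k : ℕ, k < Fintype.card V → ∃ l : List V, l.toFinset.card = k + 1 ∧
      l.length = 2 * k + 1 ∧ ∀ f : V → ℝ, listEnergy f l ≤
        ∑ u ∈ l.toFinset, ∑ v ∈ l.toFinset, if G.Adj u v then (f u - f v) ^ 2 else 0 := by
    intro k
    induction k with
    | zero =>
      intro _
      obtain ⟨a⟩ := hG.nonempty
      exact ⟨[a], by simp, by simp, fun f => by simp [listEnergy]⟩
    | succ k ih =>
      intro hk
      obtain ⟨l, hcard, hlen, hl⟩ := ih (by omega)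
      obtain ⟨b, hb⟩ : ∃ b, b ∉ l.toFinset := by
        by_contra! h
        rw [Finset.eq_univ_of_forall h, Finset.card_univ] at hcard
        omega
      obtain ⟨a, ha⟩ : l.toFinset.Nonempty := Finset.card_pos.1 (by omega)
      obtain ⟨u, v, huv, hu, hv⟩ := hG.exists_adj_mem_notMem (S := (l.toFinset : Set V)) ha hb
      simp only [Finset.mem_coe] at hu hv
      obtain ⟨p, q, rfl⟩ := List.append_of_mem (List.mem_toFinset.1 hu)
      have hset : (p ++ u :: v :: u :: q).toFinset = insert v (p ++ u :: q).toFinset := by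
        ext w; simp
      refine ⟨p ++ u :: v :: u :: q, ?_, ?_, fun f => ?_⟩
      · rw [hset, Finset.card_insert_of_notMem hv, hcard]
      · simp at hlen ⊢; omega
      · rw [hset]
        set S := (p ++ u :: q).toFinset
        have hf := hl f
        rw [listEnergy_append_cons] at hf ⊢
        simp only [listEnergy]
        rw [Finset.sum_insert hv, Finset.sum_insert hv]
        simp_rw [Finset.sum_insert hv]
        rw [Finset.sum_add_distrib]
        have h1 : (f v - f u) ^ 2 ≤ ∑ x ∈ S, if G.Adj v x then (f v - f x) ^ 2 else 0 := by
          have := Finset.single_le_sum (s := S)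
            (f := fun x => if G.Adj v x then (f v - f x) ^ 2 else 0)
            (fun x _ => by positivity) hu
          simpa [huv.symm] using this
        have h2 : (f u - f v) ^ 2 ≤ ∑ x ∈ S, if G.Adj x v then (f x - f v) ^ 2 else 0 := by
          have := Finset.single_le_sum (s := S)
            (f := fun x => if G.Adj x v then (f x - f v) ^ 2 else 0)
            (fun x _ => by positivity) hu
          simpa [huv] using this
        have h3 : (0 : ℝ) ≤ if G.Adj v v then (f v - f v) ^ 2 else 0 := by positivity
        linarith
  have hpos : 0 < Fintype.card V := Fintype.card_pos_iff.2 hG.nonempty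
  obtain ⟨l, hcard, hlen, hl⟩ := key (Fintype.card V - 1) (by omega)
  have huniv : l.toFinset = Finset.univ := by
    rw [← Finset.card_eq_iff_eq_univ]; omega
  refine ⟨l, by omega, fun v => ?_, fun f => ?_⟩
  · rw [← List.mem_toFinset, huniv]; exact Finset.mem_univ v
  · simpa only [huniv, adjEnergy] using hl f

theorem exists_card_le_sum_sq_le_adjEnergy (hG : G.Connected) {ℓ K : ℕ}
    (h : 2 * Fintype.card V ≤ K * ℓ) :
    ∃ Z : Finset V, Z.card ≤ K ∧ ∀ f : V → ℝ, (∀ z ∈ Z, f z = 0) →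
      ∑ v, f v ^ 2 ≤ (ℓ : ℝ) ^ 2 * adjEnergy G f := by
  classical
  obtain ⟨l, hlen, hmem, hE⟩ := exists_tour hG
  obtain ⟨Z, hZ, hf⟩ := exists_card_le_sum_sq_le_listEnergy ℓ K l (by omega)
  refine ⟨Z, hZ, fun f hz => ?_⟩
  have huniv : l.dedup.toFinset = Finset.univ := by ext v; simp [hmem v]
  calc ∑ v, f v ^ 2 = (l.dedup.map fun v => f v ^ 2).sum := by
        rw [← huniv, List.sum_toFinset _ (List.nodup_dedup l)]
    _ ≤ (l.map fun v => f v ^ 2).sum := by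
      refine List.Sublist.sum_le_sum ((List.dedup_sublist l).map _) fun r hr => ?_
      obtain ⟨v, -, rfl⟩ := List.mem_map.1 hr
      positivity
    _ ≤ (ℓ : ℝ) ^ 2 * listEnergy f l := hf f hz
    _ ≤ _ := by gcongr; exact hE f

theorem sum_Ico_sq_sub_le {x : ℕ → ℝ} (hx : Monotone x) {a b : ℕ} (hab : a ≤ b) :
    ∑ k ∈ Finset.Ico a b, (x (k + 1) - x k) ^ 2 ≤ (x b - x a) ^ 2 := by
  induction b, hab using Nat.le_induction with
  | base => simp
  | succ b hab ih =>
    rw [Finset.sum_Ico_succ_top hab]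
    nlinarith [mul_nonneg (sub_nonneg.2 (hx hab)) (sub_nonneg.2 (hx (Nat.le_succ b)))]

/-- Fiedler's rearrangement bound: the Dirichlet form of a connected graph dominates the one of the
path, in the order of increasing values of the function. -/
theorem exists_sorted_path_energy_le (hG : G.Connected) {n : ℕ} (hn : Fintype.card V = n + 1)
    (f : V → ℝ) :
    ∃ (x : ℕ → ℝ) (e : Fin (n + 1) ≃ V), (∀ i : Fin (n + 1), x i = f (e i)) ∧
      2 * ∑ k ∈ Finset.range n, (x (k + 1) - x k) ^ 2 ≤ adjEnergy G f := by
  let e₀ : Fin (n + 1) ≃ V := (Fintype.equivFinOfCardEq hn).symm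
  let e : Fin (n + 1) ≃ V := (Tuple.sort (f ∘ e₀)).trans e₀
  have hmono : Monotone (f ∘ e) := Tuple.monotone_sort (f ∘ e₀)
  let x : ℕ → ℝ := fun i => f (e ⟨min i n, by omega⟩)
  have hx : Monotone x := fun i j hij => hmono (Fin.mk_le_mk.2 (min_le_min_right n hij))
  have hxe : ∀ i : Fin (n + 1), x i = f (e i) := fun i => by
    simp only [x]; congr; omega
  refine ⟨x, e, hxe, ?_⟩
  let p : V → ℕ := fun v => (e.symm v : ℕ)
  have hxp : ∀ v, x (p v) = f v := fun v => by rw [hxe, Equiv.apply_symm_apply]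
  let g : ℕ → ℝ := fun k => (x (k + 1) - x k) ^ 2
  let h : V → V → ℝ := fun u v => ∑ k ∈ Finset.range n, if p u ≤ k ∧ k < p v then g k else 0
  have hle : ∀ u v, p u ≤ p v → h u v ≤ (f u - f v) ^ 2 := by
    intro u v huv
    have := sum_Ico_sq_sub_le hx huv
    rw [hxp, hxp] at this
    rw [← neg_sub, neg_sq]
    refine le_trans ?_ this
    simp only [h]
    rw [← Finset.sum_filter]
    refine Finset.sum_le_sum_of_subset_of_nonneg (fun k hk => ?_) fun _ _ _ => sq_nonneg _
    rw [Finset.mem_filter] at hk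
    exact Finset.mem_Ico.2 hk.2
  have hzero : ∀ u v, p v ≤ p u → h u v = 0 := by
    intro u v huv
    exact Finset.sum_eq_zero fun k _ => if_neg (by omega)
  have hsum : ∀ u v, h u v + h v u ≤ (f u - f v) ^ 2 := by
    intro u v
    rcases le_total (p u) (p v) with huv | huv
    · rw [hzero v u huv, add_zero]; exact hle u v huv
    · rw [hzero u v huv, zero_add, ← neg_sub, neg_sq]; exact hle v u huv
  have hhalf : ∑ k ∈ Finset.range n, g k ≤ ∑ u, ∑ v, if G.Adj u v then h u v else 0 := by
    have hswap : (∑ u, ∑ v, if G.Adj u v then h u v else 0) =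
        ∑ k ∈ Finset.range n, ∑ u, ∑ v,
          if G.Adj u v ∧ p u ≤ k ∧ k < p v then g k else 0 := by
      symm
      rw [Finset.sum_comm]
      refine Finset.sum_congr rfl fun u _ => ?_
      rw [Finset.sum_comm]
      refine Finset.sum_congr rfl fun v _ => ?_
      by_cases huv : G.Adj u v <;> simp [huv, h]
    rw [hswap]
    refine Finset.sum_le_sum fun k hk => ?_
    have hkn : k < n := Finset.mem_range.1 hk
    obtain ⟨u, v, huv, hu, hv⟩ := hG.exists_adj_mem_notMem (S := {w | p w ≤ k})
      (a := e 0) (b := e (Fin.last n)) (by simp [p]) (by simp [p, hkn])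
    have hv' : k < p v := not_le.1 hv
    have hnn : ∀ a b : V, (0 : ℝ) ≤ if G.Adj a b ∧ p a ≤ k ∧ k < p b then g k else 0 := by
      intro a b; positivity
    calc g k = if G.Adj u v ∧ p u ≤ k ∧ k < p v then g k else 0 := (if_pos ⟨huv, hu, hv'⟩).symm
      _ ≤ ∑ b, if G.Adj u b ∧ p u ≤ k ∧ k < p b then g k else 0 :=
        Finset.single_le_sum (f := fun b => if G.Adj u b ∧ p u ≤ k ∧ k < p b then g k else 0)
          (fun b _ => hnn u b) (Finset.mem_univ v)
      _ ≤ _ := Finset.single_le_sum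
          (f := fun a => ∑ b, if G.Adj a b ∧ p a ≤ k ∧ k < p b then g k else 0)
          (fun a _ => Finset.sum_nonneg fun b _ => hnn a b) (Finset.mem_univ u)
  have hsymm : (∑ u, ∑ v, if G.Adj u v then h v u else 0) =
      ∑ u, ∑ v, if G.Adj u v then h u v else 0 := by
    rw [Finset.sum_comm]
    simp only [G.adj_comm]
  calc 2 * ∑ k ∈ Finset.range n, g k
      ≤ (∑ u, ∑ v, if G.Adj u v then h u v else 0) +
          ∑ u, ∑ v, if G.Adj u v then h v u else 0 := by rw [hsymm]; linarith
    _ = ∑ u, ∑ v, if G.Adj u v then h u v + h v u else 0 := by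
      simp only [← Finset.sum_add_distrib]
      refine Finset.sum_congr rfl fun u _ => Finset.sum_congr rfl fun v _ => ?_
      split_ifs <;> simp
    _ ≤ adjEnergy G f := by
      refine Finset.sum_le_sum fun u _ => Finset.sum_le_sum fun v _ => ?_
      split_ifs
      · exact hsum u v
      · rfl

/-- Fiedler's bound on the algebraic connectivity, as a Poincaré inequality. -/
theorem fiedler_poincare_inequality (hG : G.Connected) (hV : 2 ≤ Fintype.card V) {f : V → ℝ}
    (hf : ∑ v, f v = 0) :
    2 * (1 - cos (π / Fintype.card V)) * ∑ v, f v ^ 2 ≤ adjEnergy G f / 2 := by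
  obtain ⟨n, hn⟩ : ∃ n, Fintype.card V = n + 1 := ⟨Fintype.card V - 1, by omega⟩
  obtain ⟨x, e, hxe, hE⟩ := exists_sorted_path_energy_le hG hn f
  have hx : ∑ i ∈ Finset.range (n + 1), x i = 0 := by
    rw [Finset.sum_range]; simp only [hxe]; rw [Equiv.sum_comp e f, hf]
  have hP := path_poincare_inequality (by omega) x hx
  have hx2 : ∑ i ∈ Finset.range (n + 1), x i ^ 2 = ∑ v, f v ^ 2 := by
    rw [Finset.sum_range]; simp only [hxe]; exact Equiv.sum_comp e fun v => f v ^ 2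
  rw [hx2, ← hn] at hP
  linarith

end Energy

open Matrix in
/-- Courant–Fischer upper bound on the eigenvalues of a real symmetric matrix. -/
theorem Matrix.IsHermitian.eigenvalue_le_of_forall_mem_ker {V W : Type*} [Fintype V]
    [DecidableEq V] [AddCommGroup W] [Module ℝ W] [FiniteDimensional ℝ W] {A : Matrix V V ℝ}
    (hA : A.IsHermitian) {σ : Fin (Fintype.card V) ≃ V} (hσ : Antitone (hA.eigenvalues ∘ σ))
    {B : ℕ} (hB : B < Fintype.card V) (Φ : (V → ℝ) →ₗ[ℝ] W) (hW : Module.finrank ℝ W ≤ B) {c : ℝ}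
    (h : ∀ f, Φ f = 0 → f ⬝ᵥ A *ᵥ f ≤ c * ∑ v, f v ^ 2) :
    hA.eigenvalues (σ ⟨B, hB⟩) ≤ c := by
  let ι : Fin (B + 1) → V := fun i => σ ⟨i, by omega⟩
  have hι : Function.Injective ι := fun i j hij => by
    simpa [ι, Fin.ext_iff] using hij
  let b : Fin (B + 1) → V → ℝ := fun i => ⇑(hA.eigenvectorBasis (ι i))
  have hb : ∀ i j, b i ⬝ᵥ b j = if i = j then 1 else 0 := by
    intro i j
    have := orthonormal_iff_ite.1 hA.eigenvectorBasis.orthonormal (ι j) (ι i)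
    simp only [hι.eq_iff, EuclideanSpace.inner_eq_star_dotProduct, star_trivial] at this
    simpa [b, eq_comm] using this
  let Ψ : (Fin (B + 1) → ℝ) →ₗ[ℝ] (V → ℝ) := Fintype.linearCombination ℝ b
  have hker : LinearMap.ker (Φ ∘ₗ Ψ) ≠ ⊥ :=
    LinearMap.ker_ne_bot_of_finrank_lt (by simp; omega)
  obtain ⟨a, ha, ha0⟩ := Submodule.exists_mem_ne_zero_of_ne_bot hker
  have hf := h (Ψ a) ha
  have hΨ : Ψ a = ∑ i, a i • b i := Fintype.linearCombination_apply ℝ b a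
  have hdot : ∀ d : Fin (B + 1) → ℝ, (∑ i, a i • b i) ⬝ᵥ (∑ i, d i • b i) = ∑ i, a i * d i := by
    intro d
    simp [sum_dotProduct, dotProduct_sum, hb, mul_comm]
  have hAb : A *ᵥ (∑ i, a i • b i) = ∑ i, (hA.eigenvalues (ι i) * a i) • b i := by
    rw [mulVec_sum]
    refine Finset.sum_congr rfl fun i _ => ?_
    rw [mulVec_smul, hA.mulVec_eigenvectorBasis, smul_smul, mul_comm]
  have hsq : ∑ v, (Ψ a) v ^ 2 = ∑ i, a i ^ 2 := by
    have := hdot a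
    rw [← hΨ] at this
    simpa [dotProduct, sq] using this
  rw [hsq, hΨ, hAb, hdot] at hf
  have hpos : 0 < ∑ i, a i ^ 2 := by
    obtain ⟨i, hi⟩ := Function.ne_iff.1 ha0
    exact Finset.sum_pos' (fun _ _ => sq_nonneg _) ⟨i, Finset.mem_univ i, by
      have : a i ≠ 0 := hi
      positivity⟩
  refine le_of_mul_le_mul_right (le_trans ?_ hf) hpos
  rw [Finset.mul_sum]
  refine Finset.sum_le_sum fun i _ => ?_
  have : hA.eigenvalues (σ ⟨B, hB⟩) ≤ hA.eigenvalues (ι i) :=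
    hσ (Fin.mk_le_mk.2 (by omega))
  nlinarith [sq_nonneg (a i)]

open Matrix in
theorem dotProduct_one_sub_smul_lapMatrix_mulVec {V : Type*} [Fintype V] [DecidableEq V]
    (G : SimpleGraph V) [DecidableRel G.Adj] (r : ℝ) (f : V → ℝ) :
    f ⬝ᵥ ((1 : Matrix V V ℝ) - r • G.lapMatrix ℝ) *ᵥ f =
      ∑ v, f v ^ 2 - r * (adjEnergy G f / 2) := by
  have h := SimpleGraph.lapMatrix_toLinearMap₂' ℝ G f
  rw [Matrix.toLinearMap₂'_apply'] at h
  rw [sub_mulVec, dotProduct_sub, one_mulVec, smul_mulVec, dotProduct_smul, h, smul_eq_mul]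
  simp [dotProduct, sq, adjEnergy]

/-- The exponent `(δ - 1) * log 16` is at least `5` when `δ ≥ 3`. -/
theorem two_mul_pow_five_le_of_le_rpow {δ : ℕ} (hδ : 3 ≤ δ) {B m : ℕ} (hm : 1 ≤ m)
    (h : (m : ℝ) ≤ ((B : ℝ) / 2) ^ (1 / (((δ : ℝ) - 1) * Real.log 16))) : 2 * m ^ 5 ≤ B := by
  have hlog : Real.log 16 = 4 * Real.log 2 := by
    rw [show (16 : ℝ) = 2 ^ 4 by norm_num, Real.log_pow]; norm_num
  have hδ' : (3 : ℝ) ≤ δ := by exact_mod_cast hδ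
  have h5 : 5 ≤ ((δ : ℝ) - 1) * Real.log 16 := by
    rw [hlog]; nlinarith [Real.log_two_gt_d9]
  have hm' : (1 : ℝ) ≤ m := by exact_mod_cast hm
  set r := ((δ : ℝ) - 1) * Real.log 16
  have h1 : (m : ℝ) ^ r ≤ (B : ℝ) / 2 := by
    calc (m : ℝ) ^ r ≤ (((B : ℝ) / 2) ^ (1 / r)) ^ r := by gcongr
      _ = (B : ℝ) / 2 := by
        rw [← Real.rpow_mul (by positivity), one_div_mul_cancel (by linarith), Real.rpow_one]
  have h2 : (m : ℝ) ^ (5 : ℕ) ≤ (m : ℝ) ^ r := by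
    rw [← Real.rpow_natCast]
    exact Real.rpow_le_rpow_of_exponent_le hm' (by exact_mod_cast h5)
  have h3 : 2 * (m : ℝ) ^ 5 ≤ B := by linarith
  exact_mod_cast h3

theorem two_mul_one_sub_cos_mul_sq_le {m N ℓ : ℕ} (hN : 0 < N) (h : 5 * m * ℓ ≤ N) :
    2 * (1 - cos ((m : ℝ) * π / N)) * (ℓ : ℝ) ^ 2 ≤ 1 / 2 := by
  have hcos := Real.one_sub_sq_div_two_le_cos (x := (m : ℝ) * π / N)
  have hN' : (0 : ℝ) < N := by exact_mod_cast hN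
  have h' : 5 * (m : ℝ) * ℓ ≤ N := by exact_mod_cast h
  have hle : (m : ℝ) * ℓ / N ≤ 1 / 5 := by
    rw [div_le_iff₀ hN']; linarith
  have h0 : 0 ≤ (m : ℝ) * ℓ / N := by positivity
  have hπ : π ^ 2 ≤ 12 := by nlinarith [Real.pi_lt_d2, Real.pi_pos]
  calc 2 * (1 - cos ((m : ℝ) * π / N)) * (ℓ : ℝ) ^ 2
      ≤ ((m : ℝ) * π / N) ^ 2 * (ℓ : ℝ) ^ 2 := by gcongr; linarith
    _ = π ^ 2 * ((m : ℝ) * ℓ / N) ^ 2 := by ring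
    _ ≤ 12 * (1 / 5) ^ 2 := by gcongr
    _ ≤ 1 / 2 := by norm_num

/-- **Comparison of RRW eigenvalues with the path spectrum.** For a finite connected
graph on `N` vertices with maximum degree `δ ≥ 3`, `ν = 1/((δ-1)·ln 16)`, and the
path eigenvalues `β^o_j = 1 - (2/δ)(1 - cos((j-1)π/N))`, we have
`β_{B+1} ≤ β^o_{⌊(B/2)^ν⌋+1}` for every `B ∈ {0,…,N-2}`. -/
theorem rrw_path_comparison {V : Type} [Fintype V] [DecidableEq V]
    (G : SimpleGraph V) [DecidableRel G.Adj] (hG : G.Connected)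
    (δ : ℕ) (hδeq : δ = G.maxDegree) (hδ : 3 ≤ δ)
    (ν : ℝ) (hν : ν = 1 / (((δ : ℝ) - 1) * Real.log 16))
    (hA : ((1 : Matrix V V ℝ) - ((δ : ℝ))⁻¹ • G.lapMatrix ℝ).IsHermitian)
    (β : Fin (Fintype.card V) → ℝ) (hβ : Antitone β)
    (hβe : ∃ σ : Fin (Fintype.card V) ≃ V, β = hA.eigenvalues ∘ σ)
    (B : ℕ) (hB : B + 2 ≤ Fintype.card V) :
    β ⟨B, by omega⟩ ≤
      1 - (2 / (δ : ℝ)) *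
        (1 - Real.cos ((⌊((B : ℝ) / 2) ^ ν⌋₊ : ℝ) * π / (Fintype.card V : ℝ))) := by
  obtain ⟨σ, rfl⟩ := hβe
  have hδ0 : (0 : ℝ) < δ := by exact_mod_cast (by omega : 0 < δ)
  have hm : ((⌊((B : ℝ) / 2) ^ ν⌋₊ : ℕ) : ℝ) ≤ ((B : ℝ) / 2) ^ ν := Nat.floor_le (by positivity)
  generalize ⌊((B : ℝ) / 2) ^ ν⌋₊ = m at hm ⊢
  rw [hν] at hm
  set N := Fintype.card V with hN
  set c := 2 * (1 - cos ((m : ℝ) * π / N)) with hc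
  rw [show 1 - 2 / (δ : ℝ) * (1 - cos ((m : ℝ) * π / N)) = 1 - (δ : ℝ)⁻¹ * c by rw [hc]; ring]
  have hquad : ∀ f : V → ℝ, c * ∑ v, f v ^ 2 ≤ adjEnergy G f / 2 →
      dotProduct f (Matrix.mulVec ((1 : Matrix V V ℝ) - ((δ : ℝ))⁻¹ • G.lapMatrix ℝ) f) ≤
        (1 - (δ : ℝ)⁻¹ * c) * ∑ v, f v ^ 2 := by
    intro f hf
    rw [dotProduct_one_sub_smul_lapMatrix_mulVec]
    have : (δ : ℝ)⁻¹ * (c * ∑ v, f v ^ 2) ≤ (δ : ℝ)⁻¹ * (adjEnergy G f / 2) := by gcongr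
    linarith
  have hBN : B < N := by omega
  rcases Nat.lt_or_ge m 1 with hm0 | hm1
  · obtain rfl : m = 0 := by omega
    refine hA.eigenvalue_le_of_forall_mem_ker hβ hBN (0 : (V → ℝ) →ₗ[ℝ] (Fin 0 → ℝ)) (by simp)
      fun f _ => hquad f ?_
    have := adjEnergy_nonneg G f
    simp [hc]
    linarith
  have hBm := two_mul_pow_five_le_of_le_rpow hδ hm1 hm
  rcases hm1.eq_or_lt with rfl | hm2
  · refine hA.eigenvalue_le_of_forall_mem_ker hβ hBN
      (∑ v, LinearMap.proj v : (V → ℝ) →ₗ[ℝ] ℝ) (by simp; omega) fun f hf => hquad f ?_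
    have := fiedler_poincare_inequality hG (by omega) (f := f) (by simpa using hf)
    simpa [hc] using this
  · have hB32 : 32 * m ≤ B := by
      have : 2 ^ 4 ≤ m ^ 4 := Nat.pow_le_pow_left hm2 4
      nlinarith
    obtain ⟨ℓ, hℓ⟩ : ∃ ℓ, ℓ = N / (5 * m) := ⟨_, rfl⟩
    have hℓ1 : 5 * m * ℓ ≤ N := by rw [hℓ]; exact Nat.mul_div_le N (5 * m)
    have hℓ2 : N < 5 * m * (ℓ + 1) := by rw [hℓ]; exact Nat.lt_mul_div_succ N (by omega)
    have hℓ0 : 1 ≤ ℓ := by by_contra! h; nlinarith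
    have hcover : 2 * N ≤ B * ℓ := by nlinarith
    obtain ⟨Z, hZ, hf⟩ := exists_card_le_sum_sq_le_adjEnergy hG hcover
    refine hA.eigenvalue_le_of_forall_mem_ker hβ hBN
      (LinearMap.funLeft ℝ ℝ ((↑) : Z → V)) (by simpa using hZ) fun f hfz => hquad f ?_
    have h1 := hf f fun z hz => congrFun hfz ⟨z, hz⟩
    have h2 := two_mul_one_sub_cos_mul_sq_le (by omega) hℓ1
    have hE := adjEnergy_nonneg G f
    have hc0 : 0 ≤ c := by rw [hc]; linarith [cos_le_one ((m : ℝ) * π / N)]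
    calc c * ∑ v, f v ^ 2 ≤ c * ((ℓ : ℝ) ^ 2 * adjEnergy G f) := by gcongr
      _ = c * (ℓ : ℝ) ^ 2 * adjEnergy G f := by ring
      _ ≤ 1 / 2 * adjEnergy G f := by gcongr
      _ = adjEnergy G f / 2 := by ring
end

section
/- Let H be a finite connected simple graph of order N with maximum degree δ ≥ 3. Set ν = 1/((δ−1) ln 16), a = 1 + √(πδ)/2^{1−ν}, ť = 4^{1+ν}N^{1−ν}, t̂ = 4^{−(1+ν)²/ν}N⁴. Then for all t ∈ [ť, t̂], the averaged continuous-time return probability of the RRW satisfies (1/N)Tr e^{−t(I−A)} ≤ 1/N + a·(N^{1−ν}/√t)^{1/(1+ν)}·e^{−4t/(δN²)}. -/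
open Real

namespace SimpleGraph

open Matrix

variable {V : Type*} {G : SimpleGraph V}

/-- In a connected graph every distance level below `G.dist x y` is nonempty. -/
lemma Connected.dist_le_card_dist_lt [Fintype V] (hG : G.Connected) (x y : V) :
    G.dist x y ≤ (Finset.univ.filter fun z => G.dist x z < G.dist x y).card := by
  obtain ⟨p, hp, hl⟩ := hG.exists_path_of_dist x y
  rw [← Finset.card_range (G.dist x y)]
  refine Finset.card_le_card_of_injOn p.getVert (fun i hi => ?_) (fun i hi j hj hij => ?_)
  · have hi' : i < G.dist x y := by simpa using hi
    have h := SimpleGraph.dist_le (p.take i)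
    rw [Walk.take_length] at h
    simpa using lt_of_le_of_lt (h.trans (min_le_left _ _)) hi'
  · have hi' : i < G.dist x y := by simpa using hi
    have hj' : j < G.dist x y := by simpa using hj
    exact hp.getVert_injOn (by simp; omega) (by simp; omega) hij

/-- The sum of the distances from a vertex of a connected graph of order `N` is at most `N² / 2`. -/
lemma Connected.two_mul_sum_dist_le [Fintype V] (hG : G.Connected) (x : V) :
    2 * ∑ y, G.dist x y ≤ Fintype.card V ^ 2 := by
  have h1 : ∑ y, G.dist x y ≤ ∑ y, ∑ z, if G.dist x z < G.dist x y then 1 else 0 :=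
    Finset.sum_le_sum fun y _ => by simpa using hG.dist_le_card_dist_lt x y
  have h2 : ∑ y, G.dist x y ≤ ∑ y, ∑ z, if G.dist x y < G.dist x z then 1 else 0 := by
    rw [Finset.sum_comm]; exact h1
  calc 2 * ∑ y, G.dist x y
      ≤ (∑ y, ∑ z, if G.dist x z < G.dist x y then 1 else 0)
          + ∑ y, ∑ z, if G.dist x y < G.dist x z then 1 else 0 := by omega
    _ ≤ ∑ _y : V, ∑ _z : V, 1 := by
        rw [← Finset.sum_add_distrib]
        refine Finset.sum_le_sum fun y _ => ?_
        rw [← Finset.sum_add_distrib]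
        refine Finset.sum_le_sum fun z _ => ?_
        split_ifs <;> omega
    _ = Fintype.card V ^ 2 := by simp [sq]

lemma dotProduct_lapMatrix_mulVec [Fintype V] [DecidableEq V] [DecidableRel G.Adj] (f : V → ℝ) :
    f ⬝ᵥ (G.lapMatrix ℝ *ᵥ f)
      = (∑ i : V, ∑ j : V, if G.Adj i j then (f i - f j) ^ 2 else 0) / 2 := by
  rw [← lapMatrix_toLinearMap₂', toLinearMap₂'_apply']

/-- The effective resistance between two vertices is at most their distance. -/
lemma Connected.sq_sub_le_dist_mul [Fintype V] [DecidableEq V] [DecidableRel G.Adj]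
    (hG : G.Connected) (f : V → ℝ) (x y : V) :
    (f x - f y) ^ 2 ≤ G.dist x y * (f ⬝ᵥ (G.lapMatrix ℝ *ᵥ f)) := by
  obtain ⟨p, hp, hl⟩ := hG.exists_path_of_dist x y
  set n := G.dist x y with hn
  set g := p.getVert
  have hadj : ∀ i < n, G.Adj (g i) (g (i + 1)) := fun i hi => p.adj_getVert_succ (by omega)
  have hinj : ∀ i ≤ n, ∀ j ≤ n, g i = g j → i = j := fun i hi j hj h =>
    hp.getVert_injOn (by simp; omega) (by simp; omega) h
  have htel : f x - f y = ∑ i ∈ Finset.range n, (f (g i) - f (g (i + 1))) := by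
    rw [Finset.sum_range_sub' (fun i => f (g i))]
    simp [g, ← hl]
  let F : V × V → ℝ := fun q => if G.Adj q.1 q.2 then (f q.1 - f q.2) ^ 2 else 0
  have hF : ∀ q, 0 ≤ F q := fun q => by dsimp only [F]; split_ifs <;> positivity
  let S₁ := (Finset.range n).image fun i => (g i, g (i + 1))
  let S₂ := (Finset.range n).image fun i => (g (i + 1), g i)
  have hs₁ : ∑ q ∈ S₁, F q = ∑ i ∈ Finset.range n, (f (g i) - f (g (i + 1))) ^ 2 := by
    rw [Finset.sum_image]
    · exact Finset.sum_congr rfl fun i hi => if_pos (hadj i (by simpa using hi))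
    · intro i hi j hj h
      simp only [Finset.coe_range, Set.mem_Iio] at hi hj
      exact hinj i hi.le j hj.le (Prod.ext_iff.1 h).1
  have hs₂ : ∑ q ∈ S₂, F q = ∑ i ∈ Finset.range n, (f (g i) - f (g (i + 1))) ^ 2 := by
    rw [Finset.sum_image]
    · refine Finset.sum_congr rfl fun i hi => ?_
      rw [show F (g (i + 1), g i) = (f (g (i + 1)) - f (g i)) ^ 2 from
        if_pos (hadj i (by simpa using hi)).symm]
      ring
    · intro i hi j hj h
      simp only [Finset.coe_range, Set.mem_Iio] at hi hj
      exact hinj i hi.le j hj.le (Prod.ext_iff.1 h).2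
  have hdisj : Disjoint S₁ S₂ := by
    rw [Finset.disjoint_left]
    intro q h₁ h₂
    obtain ⟨i, hi, rfl⟩ := Finset.mem_image.1 h₁
    obtain ⟨j, hj, h⟩ := Finset.mem_image.1 h₂
    simp only [Finset.mem_range] at hi hj
    have h1 := hinj _ (by omega) _ (by omega) (Prod.ext_iff.1 h).1
    have h2 := hinj _ (by omega) _ (by omega) (Prod.ext_iff.1 h).2
    omega
  have hle : ∑ i ∈ Finset.range n, (f (g i) - f (g (i + 1))) ^ 2
      ≤ f ⬝ᵥ (G.lapMatrix ℝ *ᵥ f) := by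
    have h : ∑ q ∈ S₁ ∪ S₂, F q ≤ ∑ q, F q :=
      Finset.sum_le_sum_of_subset_of_nonneg (Finset.subset_univ _) fun q _ _ => hF q
    rw [Finset.sum_union hdisj, hs₁, hs₂, Fintype.sum_prod_type] at h
    rw [dotProduct_lapMatrix_mulVec]
    simp only [F] at h
    linarith
  calc (f x - f y) ^ 2
      ≤ n * ∑ i ∈ Finset.range n, (f (g i) - f (g (i + 1))) ^ 2 := by
        rw [htel]
        simpa using sq_sum_le_card_mul_sum_sq (s := Finset.range n)
          (f := fun i => f (g i) - f (g (i + 1)))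
    _ ≤ _ := by gcongr

/-- Orthonormal Laplacian eigenvectors `φ` of a connected graph of order `N` with eigenvalues `l`
satisfy `∑ 1 / l ≤ N² / 4` over the nonzero eigenvalues. -/
lemma Connected.sum_inv_eigenvalues_le [Fintype V] [DecidableEq V] [DecidableRel G.Adj]
    (hG : G.Connected) {ι : Type*} [DecidableEq ι] (K : Finset ι) (φ : ι → V → ℝ) (l : ι → ℝ)
    (hφ : ∀ j k, φ j ⬝ᵥ φ k = if j = k then 1 else 0)
    (hl : ∀ k, G.lapMatrix ℝ *ᵥ φ k = l k • φ k) (hK : ∀ k ∈ K, l k ≠ 0) :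
    ∑ k ∈ K, 1 / l k ≤ (Fintype.card V : ℝ) ^ 2 / 4 := by
  have hmean : ∀ k ∈ K, ∑ v, φ k v = 0 := by
    intro k hk
    have h : (fun _ => (1 : ℝ)) ⬝ᵥ (G.lapMatrix ℝ *ᵥ φ k) = 0 := by
      rw [dotProduct_mulVec, ← mulVec_transpose, (G.isSymm_lapMatrix (R := ℝ)).eq,
        lapMatrix_mulVec_const_eq_zero, zero_dotProduct]
    rw [hl, dotProduct_smul, smul_eq_mul, mul_eq_zero] at h
    simpa [dotProduct] using h.resolve_left (hK k hk)
  have hres : ∀ x y, ∑ k ∈ K, (φ k x - φ k y) ^ 2 / l k ≤ G.dist x y := by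
    intro x y
    set R := ∑ k ∈ K, (φ k x - φ k y) ^ 2 / l k with hR
    let c : ι → ℝ := fun k => (φ k x - φ k y) / l k
    let f : V → ℝ := ∑ k ∈ K, c k • φ k
    have hf : f x - f y = R := by
      simp only [f, c, Finset.sum_apply, Pi.smul_apply, smul_eq_mul, hR, ← Finset.sum_sub_distrib]
      exact Finset.sum_congr rfl fun k _ => by ring
    have hE : f ⬝ᵥ (G.lapMatrix ℝ *ᵥ f) = R := by
      simp only [f, mulVec_sum, mulVec_smul, hl, dotProduct_sum, sum_dotProduct, smul_dotProduct,
        dotProduct_smul, hφ, smul_eq_mul]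
      refine Finset.sum_congr rfl fun k hk => ?_
      rw [Finset.sum_eq_single_of_mem k hk (fun j _ hj => by simp [hj])]
      have := hK k hk
      simp only [c, if_true]
      field_simp
    have h := hG.sq_sub_le_dist_mul f x y
    rw [hf, hE] at h
    have hd : (0 : ℝ) ≤ G.dist x y := by positivity
    nlinarith
  have hpair : ∀ k ∈ K, ∑ x, ∑ y, (φ k x - φ k y) ^ 2 = 2 * Fintype.card V := by
    intro k hk
    have h1 : ∑ v, φ k v ^ 2 = 1 := by simpa [dotProduct, sq] using hφ k k
    have h2 := hmean k hk
    simp only [sub_sq, Finset.sum_add_distrib, Finset.sum_sub_distrib, ← Finset.mul_sum,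
      h1, h2, Finset.sum_const, Finset.card_univ, nsmul_eq_mul]
    simp
    ring
  have hsum : 2 * Fintype.card V * ∑ k ∈ K, 1 / l k ≤ (Fintype.card V : ℝ) ^ 3 / 2 := by
    calc 2 * Fintype.card V * ∑ k ∈ K, 1 / l k
        = ∑ k ∈ K, ∑ x, ∑ y, (φ k x - φ k y) ^ 2 / l k := by
          rw [Finset.mul_sum]
          refine Finset.sum_congr rfl fun k hk => ?_
          simp only [← Finset.sum_div]
          rw [hpair k hk]
          ring
      _ = ∑ x, ∑ y, ∑ k ∈ K, (φ k x - φ k y) ^ 2 / l k := by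
          rw [Finset.sum_comm]
          exact Finset.sum_congr rfl fun x _ => Finset.sum_comm
      _ ≤ ∑ x, ∑ y, (G.dist x y : ℝ) := by gcongr; exact hres _ _
      _ ≤ ∑ _x : V, (Fintype.card V : ℝ) ^ 2 / 2 := by
          refine Finset.sum_le_sum fun x _ => ?_
          have h : ((2 * ∑ y, G.dist x y : ℕ) : ℝ) ≤ ((Fintype.card V ^ 2 : ℕ) : ℝ) :=
            Nat.cast_le.2 (hG.two_mul_sum_dist_le x)
          push_cast at h
          linarith
      _ = (Fintype.card V : ℝ) ^ 3 / 2 := by simp; ring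
  have := hG.nonempty
  have hN : (0 : ℝ) < Fintype.card V := by exact_mod_cast Fintype.card_pos
  nlinarith

/-- Orthonormal harmonic functions on a connected graph are unique. -/
lemma Connected.card_harmonic_le_one [Fintype V] [DecidableEq V] [DecidableRel G.Adj]
    (hG : G.Connected) {ι : Type*} [DecidableEq ι] (K : Finset ι) (φ : ι → V → ℝ)
    (hφ : ∀ j k, φ j ⬝ᵥ φ k = if j = k then 1 else 0)
    (hK : ∀ k ∈ K, G.lapMatrix ℝ *ᵥ φ k = 0) : K.card ≤ 1 := by
  rw [Finset.card_le_one]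
  intro j hj k hk
  by_contra hjk
  obtain ⟨v⟩ := hG.nonempty
  have hconst : ∀ i ∈ K, φ i = fun _ => φ i v := fun i hi => funext fun w =>
    (lapMatrix_mulVec_eq_zero_iff_forall_reachable G).1 (hK i hi) w v (hG.preconnected w v)
  have h0 := hφ j k
  have h1 := hφ j j
  have h2 := hφ k k
  rw [hconst j hj, hconst k hk, if_neg hjk] at h0
  rw [hconst j hj, if_pos rfl] at h1
  rw [hconst k hk, if_pos rfl] at h2
  simp only [dotProduct, Finset.sum_const, nsmul_eq_mul] at h0 h1 h2
  have h3 : (1 : ℝ) = 0 := by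
    calc (1 : ℝ) = ((Finset.univ : Finset V).card * (φ j v * φ j v))
          * ((Finset.univ : Finset V).card * (φ k v * φ k v)) := by rw [h1, h2, one_mul]
      _ = ((Finset.univ : Finset V).card * (φ j v * φ k v)) ^ 2 := by ring
      _ = 0 := by rw [h0]; ring
  exact one_ne_zero h3

end SimpleGraph

/-- A termwise interpolation between exponential decay at rate `1` and the decay `1 / m`. -/
lemma exp_neg_mul_le {w m : ℝ} (hw : 0 < w) (hm : 1 ≤ m) :
    Real.exp (-(w * m)) ≤ Real.exp (-w) * ((1 + 1 / w) * (1 / m)) := by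
  have h : Real.exp (-(w * (m - 1))) ≤ (1 + 1 / w) * (1 / m) := by
    have h1 := Real.add_one_le_exp (w * (m - 1))
    have h2 : 0 ≤ w * (m - 1) := mul_nonneg hw.le (by linarith)
    rw [Real.exp_neg, inv_le_comm₀ (Real.exp_pos _) (by positivity)]
    refine le_trans ?_ h1
    rw [inv_le_iff_one_le_mul₀ (by positivity)]
    have h3 : (w * (m - 1) + 1) * ((1 + 1 / w) * (1 / m)) - 1
        = ((w * (m - 1) + 1) * (w + 1) - w * m) / (w * m) := by
      field_simp
    have h4 : 0 ≤ ((w * (m - 1) + 1) * (w + 1) - w * m) / (w * m) := by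
      apply div_nonneg _ (by positivity)
      nlinarith [mul_nonneg hw.le h2]
    linarith
  calc Real.exp (-(w * m)) = Real.exp (-w) * Real.exp (-(w * (m - 1))) := by
        rw [← Real.exp_add]; ring_nf
    _ ≤ _ := by gcongr

/-- If positive numbers `l` satisfy `∑ 1 / l ≤ M`, then `∑ exp (-t l)` is controlled both by its
number of terms and by `1 + M / t`, with decay rate `1 / M`. -/
lemma sum_exp_neg_le {ι : Type*} (K : Finset ι) (l : ι → ℝ) {M t : ℝ} (hM : 0 < M) (ht : 0 < t)
    (hl : ∀ k ∈ K, 0 < l k) (hsum : ∑ k ∈ K, 1 / l k ≤ M) :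
    ∑ k ∈ K, Real.exp (-t * l k) ≤ K.card * Real.exp (-(t / M)) ∧
      ∑ k ∈ K, Real.exp (-t * l k) ≤ (1 + M / t) * Real.exp (-(t / M)) := by
  have hm : ∀ k ∈ K, 1 ≤ M * l k := by
    intro k hk
    have h : 1 / l k ≤ M := le_trans
      (Finset.single_le_sum (f := fun k => 1 / l k) (fun i hi => (one_div_pos.2 (hl i hi)).le) hk)
      hsum
    rwa [div_le_iff₀ (hl k hk)] at h
  have he : ∀ k, -t * l k = -(t / M * (M * l k)) := fun k => by field_simp
  constructor
  · calc ∑ k ∈ K, Real.exp (-t * l k) ≤ ∑ _k ∈ K, Real.exp (-(t / M)) := by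
          refine Finset.sum_le_sum fun k hk => Real.exp_le_exp.2 ?_
          rw [he, neg_le_neg_iff]
          exact le_mul_of_one_le_right (by positivity) (hm k hk)
      _ = _ := by simp
  · calc ∑ k ∈ K, Real.exp (-t * l k)
        ≤ ∑ k ∈ K, Real.exp (-(t / M)) * ((1 + 1 / (t / M)) * (1 / (M * l k))) := by
          refine Finset.sum_le_sum fun k hk => ?_
          rw [he]
          exact exp_neg_mul_le (by positivity) (hm k hk)
      _ = Real.exp (-(t / M)) * (1 + M / t) * ((∑ k ∈ K, 1 / l k) / M) := by
          rw [Finset.sum_div, Finset.mul_sum]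
          refine Finset.sum_congr rfl fun k hk => ?_
          rw [one_div_div, div_div, mul_comm M, mul_assoc]
      _ ≤ Real.exp (-(t / M)) * (1 + M / t) * 1 := by
          gcongr
          rwa [div_le_one hM]
      _ = _ := by ring

/-- In the nontrivial range `√t > N^(1-ν)`, the claimed profile dominates `1 + δN² / (4t)`. -/
lemma one_add_div_le_mul_rpow {N δ ν t : ℝ} (hN : 1 ≤ N) (hδ : 3 ≤ δ)
    (hν : ν = 1 / ((δ - 1) * Real.log 16)) (ht0 : 0 < t)
    (ht : t ≤ (4 : ℝ) ^ (-(1 + ν) ^ 2 / ν) * N ^ (4 : ℕ))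
    (hx : N ^ (1 - ν) / Real.sqrt t < 1) :
    1 + δ * N ^ 2 / 4 / t ≤ N * (N ^ (1 - ν) / Real.sqrt t) ^ (1 / (1 + ν)) := by
  have hlog : 2 ≤ Real.log 16 := by
    rw [show (16 : ℝ) = 2 ^ (4 : ℕ) by norm_num, Real.log_pow]
    push_cast
    linarith [Real.log_two_gt_d9]
  have hν0 : 0 < ν := by rw [hν]; apply one_div_pos.2; nlinarith
  have hν' : 2 * (δ - 1) ≤ 1 / ν := by rw [hν, one_div_one_div]; nlinarith
  have hν4 : ν ≤ 1 / 4 := by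
    rw [le_div_iff₀ hν0] at hν'
    nlinarith
  have hN0 : 0 < N := by linarith
  have hst : 0 < Real.sqrt t := Real.sqrt_pos.2 ht0
  set x := N ^ (1 - ν) / Real.sqrt t with hxdef
  have hx0 : 0 < x := by positivity
  set y := x ^ (1 / (1 + ν)) with hydef
  have hy0 : 0 < y := by positivity
  have hy1 : y ≤ 1 := Real.rpow_le_one hx0.le hx.le (by positivity)
  have hxy : x ≤ y := by
    conv_lhs => rw [← Real.rpow_one x]
    refine Real.rpow_le_rpow_of_exponent_ge hx0 hx.le ?_
    rw [div_le_one (by positivity)]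
    linarith
  -- the upper end of the time range bounds the profile from below
  have hNy : (2 : ℝ) ^ ((1 + ν) / ν) ≤ N * y := by
    have hsqrt : Real.sqrt t ≤ (2 : ℝ) ^ (-(1 + ν) ^ 2 / ν) * N ^ (2 : ℕ) := by
      refine Real.sqrt_le_iff.2 ⟨by positivity, ht.trans (le_of_eq ?_)⟩
      rw [mul_pow, ← pow_mul, ← Real.rpow_natCast ((2 : ℝ) ^ _), ← Real.rpow_mul (by norm_num),
        show (4 : ℝ) = 2 ^ (2 : ℝ) by norm_num, ← Real.rpow_mul (by norm_num)]
      norm_num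
      left
      ring_nf
    have hxl : (N⁻¹ * (2 : ℝ) ^ ((1 + ν) / ν)) ^ (1 + ν) ≤ x := by
      rw [hxdef, le_div_iff₀ hst]
      calc _ ≤ (N⁻¹ * (2 : ℝ) ^ ((1 + ν) / ν)) ^ (1 + ν)
            * ((2 : ℝ) ^ (-(1 + ν) ^ 2 / ν) * N ^ (2 : ℕ)) := by gcongr
        _ = ((2 : ℝ) ^ ((1 + ν) / ν * (1 + ν)) * (2 : ℝ) ^ (-(1 + ν) ^ 2 / ν))
            * (N ^ (-(1 + ν)) * N ^ (2 : ℝ)) := by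
          rw [Real.mul_rpow (by positivity) (by positivity), ← Real.rpow_mul (by norm_num),
            Real.inv_rpow hN0.le, Real.rpow_neg hN0.le, Real.rpow_two]
          ring
        _ = N ^ (1 - ν) := by
          rw [← Real.rpow_add (by norm_num), ← Real.rpow_add hN0,
            show (1 + ν) / ν * (1 + ν) + -(1 + ν) ^ 2 / ν = 0 by ring, Real.rpow_zero, one_mul]
          congr 1
          ring
    have h : N⁻¹ * (2 : ℝ) ^ ((1 + ν) / ν) ≤ y := by
      rw [hydef, one_div]
      exact (Real.le_rpow_inv_iff_of_pos (by positivity) hx0.le (by positivity)).2 hxl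
    rwa [inv_mul_le_iff₀ hN0] at h
  have hNy2 : 2 ≤ N * y := by
    refine le_trans ?_ hNy
    conv_lhs => rw [← Real.rpow_one 2]
    refine Real.rpow_le_rpow_of_exponent_le (by norm_num) ?_
    rw [le_div_iff₀ hν0]
    linarith
  have hNbig : δ ≤ N ^ (1 / 2 : ℝ) := by
    have h1 : (2 : ℝ) ^ (2 * (δ - 1)) ≤ N := by
      refine le_trans (Real.rpow_le_rpow_of_exponent_le (by norm_num) ?_)
        (hNy.trans (mul_le_of_le_one_right hN0.le hy1))
      rw [add_div, div_self hν0.ne']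
      linarith
    have h2 : (2 : ℝ) ^ (δ - 1) ≤ N ^ (1 / 2 : ℝ) := by
      refine le_trans (le_of_eq ?_) (Real.rpow_le_rpow (by positivity) h1 (by norm_num))
      rw [← Real.rpow_mul (by norm_num)]
      congr 1
      ring
    refine le_trans ?_ h2
    have h3 := one_add_mul_self_le_rpow_one_add (s := (1 : ℝ)) (by norm_num) (p := δ - 1)
      (by linarith)
    norm_num at h3
    linarith
  have hN2ν : δ * N ^ (2 * ν) ≤ N := by
    calc δ * N ^ (2 * ν) ≤ N ^ (1 / 2 : ℝ) * N ^ (1 / 2 : ℝ) := by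
          gcongr
          linarith
      _ = N := by
          rw [← Real.rpow_add hN0]
          norm_num
  have hM : δ * N ^ 2 / 4 / t ≤ N * y / 4 := by
    have hN2 : N ^ 2 = N ^ (2 * ν) * (N ^ (1 - ν)) ^ 2 := by
      rw [← Real.rpow_natCast (N ^ (1 - ν)), ← Real.rpow_mul hN0.le, ← Real.rpow_add hN0,
        ← Real.rpow_natCast]
      congr 1
      push_cast
      ring
    have hxx : (N ^ (1 - ν)) ^ 2 / t = x ^ 2 := by
      rw [hxdef, div_pow, Real.sq_sqrt ht0.le]
    calc δ * N ^ 2 / 4 / t = δ * N ^ (2 * ν) * ((N ^ (1 - ν)) ^ 2 / t) / 4 := by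
          rw [hN2]
          ring
      _ = δ * N ^ (2 * ν) * x ^ 2 / 4 := by rw [hxx]
      _ ≤ N * y / 4 := by
          have : x ^ 2 ≤ y := by nlinarith
          gcongr
  linarith

/-- **Main theorem: improved return probability bound for the RRW.**
For a finite connected simple graph of order `N` with maximum degree `δ ≥ 3`,
`ν = 1/((δ-1)ln 16)`, `a = 1 + √(πδ)/2^{1-ν}`, `ť = 4^{1+ν}N^{1-ν}`,
`t̂ = 4^{-(1+ν)²/ν}N⁴`, and all `t ∈ [ť, t̂]`:
`(1/N)Tr e^{-t(I-A)} ≤ 1/N + a·(N^{1-ν}/√t)^{1/(1+ν)}·e^{-4t/(δN²)}`. -/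
theorem rrw_main_return_bound {V : Type} [Fintype V] [DecidableEq V]
    (G : SimpleGraph V) [DecidableRel G.Adj] (hG : G.Connected)
    (N δ : ℕ) (hN : N = Fintype.card V) (hδeq : δ = G.maxDegree) (hδ : 3 ≤ δ)
    (ν a tc th : ℝ) (hν : ν = 1 / (((δ : ℝ) - 1) * Real.log 16))
    (ha : a = 1 + Real.sqrt (π * δ) / (2 : ℝ) ^ (1 - ν))
    (htc : tc = (4 : ℝ) ^ (1 + ν) * (N : ℝ) ^ (1 - ν))
    (hth : th = (4 : ℝ) ^ (-(1 + ν) ^ 2 / ν) * (N : ℝ) ^ (4 : ℕ))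
    (hA : ((1 : Matrix V V ℝ) - ((δ : ℝ))⁻¹ • G.lapMatrix ℝ).IsHermitian)
    (t : ℝ) (ht : t ∈ Set.Icc tc th) :
    (1 / (N : ℝ)) * ∑ v : V, Real.exp (-t * (1 - hA.eigenvalues v)) ≤
      1 / (N : ℝ) +
        a * ((N : ℝ) ^ (1 - ν) / Real.sqrt t) ^ (1 / (1 + ν)) *
          Real.exp (-4 * t / ((δ : ℝ) * (N : ℝ) ^ 2)) := by
  classical
  have hVne := hG.nonempty
  have hN1 : (1 : ℝ) ≤ N := by
    have : 0 < Fintype.card V := Fintype.card_pos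
    exact_mod_cast hN ▸ this
  have hN0 : (0 : ℝ) < N := by linarith
  have hδ3 : (3 : ℝ) ≤ δ := by exact_mod_cast hδ
  have hδ0 : (0 : ℝ) < δ := by linarith
  have ht0 : 0 < t := lt_of_lt_of_le (by rw [htc]; positivity) ht.1
  let φ : V → V → ℝ := fun k => ⇑(hA.eigenvectorBasis k)
  let m : V → ℝ := fun k => 1 - hA.eigenvalues k
  have hφ : ∀ j k, dotProduct (φ j) (φ k) = if j = k then 1 else 0 := fun j k => by
    have h := orthonormal_iff_ite.1 hA.eigenvectorBasis.orthonormal k j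
    rw [EuclideanSpace.inner_eq_star_dotProduct] at h
    simpa [φ, eq_comm] using h
  have hLφ : ∀ k, (G.lapMatrix ℝ).mulVec (φ k) = (δ * m k) • φ k := fun k => by
    have h := hA.mulVec_eigenvectorBasis k
    rw [Matrix.sub_mulVec, Matrix.one_mulVec, Matrix.smul_mulVec] at h
    have h' : (δ : ℝ)⁻¹ • ((G.lapMatrix ℝ).mulVec (φ k)) = m k • φ k := by
      simp only [m, sub_smul, one_smul, φ, ← h, sub_sub_cancel]
    rw [mul_smul, ← h', smul_smul, mul_inv_cancel₀ hδ0.ne', one_smul]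
  have hm0 : ∀ k, 0 ≤ m k := fun k => by
    have h := (G.posSemidef_lapMatrix (R := ℝ)).dotProduct_mulVec_nonneg (φ k)
    rw [star_trivial, hLφ, dotProduct_smul, hφ, if_pos rfl, smul_eq_mul, mul_one] at h
    exact nonneg_of_mul_nonneg_right h hδ0
  let K : Finset V := Finset.univ.filter fun k => m k ≠ 0
  have hKpos : ∀ k ∈ K, 0 < m k := fun k hk =>
    lt_of_le_of_ne (hm0 k) (Ne.symm (by simpa [K] using hk))
  have hinv : ∑ k ∈ K, 1 / m k ≤ δ * (N : ℝ) ^ 2 / 4 := by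
    have h := hG.sum_inv_eigenvalues_le K φ (fun k => δ * m k) hφ hLφ
      fun k hk => (mul_pos hδ0 (hKpos k hk)).ne'
    have h' : ∑ k ∈ K, 1 / m k = δ * ∑ k ∈ K, 1 / (δ * m k) := by
      rw [Finset.mul_sum]
      refine Finset.sum_congr rfl fun k _ => ?_
      rw [one_div, one_div, mul_inv, mul_inv_cancel_left₀ hδ0.ne']
    rw [h', hN, mul_div_assoc]
    gcongr
  have hM : 0 < δ * (N : ℝ) ^ 2 / 4 := by positivity
  obtain ⟨hcard, hdecay⟩ := sum_exp_neg_le K m hM ht0 hKpos hinv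
  have hexp : -4 * t / ((δ : ℝ) * (N : ℝ) ^ 2) = -(t / (δ * (N : ℝ) ^ 2 / 4)) := by
    field_simp
  have ha1 : 1 ≤ a := by
    rw [ha]
    linarith [show 0 ≤ Real.sqrt (π * δ) / (2 : ℝ) ^ (1 - ν) by positivity]
  have hν0 : 0 < 1 + ν := by
    have : 0 ≤ ν := by
      rw [hν]
      exact one_div_nonneg.2 (mul_nonneg (by linarith) (Real.log_nonneg (by norm_num)))
    linarith
  have hmain : ∑ k ∈ K, Real.exp (-t * m k) ≤ N * ((N : ℝ) ^ (1 - ν) / Real.sqrt t) ^ (1 / (1 + ν))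
      * Real.exp (-(t / (δ * (N : ℝ) ^ 2 / 4))) := by
    rcases lt_or_ge ((N : ℝ) ^ (1 - ν) / Real.sqrt t) 1 with hx | hx
    · refine hdecay.trans ?_
      gcongr
      exact one_add_div_le_mul_rpow hN1 hδ3 hν ht0 (hth ▸ ht.2) hx
    · refine hcard.trans ?_
      gcongr
      calc (K.card : ℝ) ≤ N := by
            rw [hN]
            exact_mod_cast Finset.card_le_univ K
        _ ≤ _ := le_mul_of_one_le_right hN0.le (Real.one_le_rpow hx (by positivity))
  have hker : ∑ k ∈ Finset.univ.filter (fun k => ¬ m k ≠ 0), Real.exp (-t * m k) ≤ 1 := by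
    have h := hG.card_harmonic_le_one (Finset.univ.filter fun k => ¬ m k ≠ 0) φ hφ fun k hk => by
      rw [hLφ, show m k = 0 by simpa using hk, mul_zero, zero_smul]
    calc _ = ∑ _k ∈ Finset.univ.filter (fun k => ¬ m k ≠ 0), (1 : ℝ) :=
          Finset.sum_congr rfl fun k hk => by
            rw [show m k = 0 by simpa using hk, mul_zero, Real.exp_zero]
      _ ≤ 1 := by simpa using h
  have hsplit : ∑ v : V, Real.exp (-t * (1 - hA.eigenvalues v))
      = ∑ k ∈ K, Real.exp (-t * m k)
        + ∑ k ∈ Finset.univ.filter (fun k => ¬ m k ≠ 0), Real.exp (-t * m k) :=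
    (Finset.sum_filter_add_sum_filter_not _ _ _).symm
  rw [hsplit, hexp]
  set y := ((N : ℝ) ^ (1 - ν) / Real.sqrt t) ^ (1 / (1 + ν))
  set E := Real.exp (-(t / (δ * (N : ℝ) ^ 2 / 4)))
  have hyE : 0 ≤ y * E := by positivity
  calc _ ≤ 1 / (N : ℝ) * (N * y * E + 1) := by gcongr
    _ = 1 / N + y * E := by field_simp; ring
    _ ≤ 1 / N + a * (y * E) := by linarith [le_mul_of_one_le_left hyE ha1]
    _ = _ := by ring
end
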